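/- arXiv:2001.05589 — 7 statements merged into one kernel-verified Lean document; each statement's English description precedes it below -/
import Mathlib

section
/- For every n ≥ 1 and every integer k with k > e·n^{2/3}, there exists a permutation π of [n] containing no pair of twins of length k; in particular t(n) = O(n^{2/3}). -/
/-- `f` and `g` enumerate (in increasing order of positions) a pair of twins in the
permutation `π`: both are strictly monotone position sequences, with disjoint ranges,
and the two subsequences of `π` are order-isomorphic. -/
def IsTwinPair {n : ℕ} (π : Equiv.Perm (Fin n)) {k : ℕ} (f g : Fin k → Fin n) : Prop :=
  StrictMono f ∧ StrictMono g ∧ (∀ a b : Fin k, f a ≠ g b) ∧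
    (∀ a b : Fin k, π (f a) < π (f b) ↔ π (g a) < π (g b))

/-- `π` contains a pair of twins of length `k`. -/
def HasTwins {n : ℕ} (π : Equiv.Perm (Fin n)) (k : ℕ) : Prop :=
  ∃ f g : Fin k → Fin n, IsTwinPair π f g

/-- `t(π)`: the maximum length of a pair of twins in `π`. -/
noncomputable def twinLen {n : ℕ} (π : Equiv.Perm (Fin n)) : ℕ :=
  sSup {k | HasTwins π k}

/-- The range of `f` is a block (a set of consecutive positions). -/
def IsBlockFun {n k : ℕ} (f : Fin k → Fin n) : Prop :=
  ∃ s : ℕ, ∀ a : Fin k, (f a : ℕ) = s + (a : ℕ)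

/-- `π` contains a pair of block twins of length `k`. -/
def HasBlockTwins {n : ℕ} (π : Equiv.Perm (Fin n)) (k : ℕ) : Prop :=
  ∃ f g : Fin k → Fin n, IsTwinPair π f g ∧ IsBlockFun f ∧ IsBlockFun g

/-- The union of the ranges of `f` and `g` is a block (a set of `2k` consecutive positions). -/
def IsTightPair {n k : ℕ} (f g : Fin k → Fin n) : Prop :=
  ∃ s : ℕ, ∀ x : Fin n,
    ((∃ a, f a = x) ∨ (∃ a, g a = x)) ↔ (s ≤ (x : ℕ) ∧ (x : ℕ) < s + 2 * k)

/-- `π` contains a pair of tight twins of length `k`. -/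
def HasTightTwins {n : ℕ} (π : Equiv.Perm (Fin n)) (k : ℕ) : Prop :=
  ∃ f g : Fin k → Fin n, IsTwinPair π f g ∧ IsTightPair f g

/-- Two injections with the same order pattern, one of which is a rearrangement of the other,
are related by the trivial rearrangement. -/
lemma perm_eq_one_of_lt_iff_lt {ι α : Type*} [Fintype ι] [LinearOrder α] {u : ι → α}
    (hu : Function.Injective u) (σ : Equiv.Perm ι)
    (h : ∀ a b, u (σ a) < u (σ b) ↔ u a < u b) : σ = 1 := by
  classical
  set rank : ι → ℕ := fun a => {b | u b < u a}.toFinset.card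
  have rank_lt : ∀ x y, u x < u y → rank x < rank y := by
    intro x y hxy
    apply Finset.card_lt_card
    rw [Finset.ssubset_iff_of_subset]
    · exact ⟨x, by simpa using hxy, by simp⟩
    · intro b hb
      simp only [Set.mem_toFinset, Set.mem_ofPred_eq] at hb ⊢
      exact hb.trans hxy
  have rank_perm : ∀ a, rank (σ a) = rank a := by
    intro a
    symm
    refine Finset.card_bij (fun b _ => σ b) ?_ ?_ ?_
    · intro b hb
      simpa [h] using hb
    · intro b _ c _ hbc
      exact σ.injective hbc
    · intro b hb
      refine ⟨σ.symm b, ?_, by simp⟩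
      rw [Set.mem_toFinset, Set.mem_ofPred_eq] at hb ⊢
      rw [← h]
      simpa using hb
  ext a
  apply hu
  rcases lt_trichotomy (u (σ a)) (u a) with hlt | heq | hlt
  · exact absurd (rank_perm a) (rank_lt _ _ hlt).ne
  · exact heq
  · exact absurd (rank_perm a) (rank_lt _ _ hlt).ne'

open Classical in
/-- A fixed pair of position sequences of length `k` forms twins in at most a `1 / k!` fraction
of all permutations. -/
lemma card_isTwinPair_mul_factorial_le {n k : ℕ} (f g : Fin k → Fin n) :
    (Finset.univ.filter fun π : Equiv.Perm (Fin n) => IsTwinPair π f g).card * k.factorial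
      ≤ n.factorial := by
  by_cases hg : StrictMono g
  swap
  · rw [Finset.filter_eq_empty_iff.2 fun π _ h => hg h.2.1]
    simp
  let ι : Fin k ↪ Fin n := ⟨g, hg.injective⟩
  have hperm : ∀ m : ℕ, (Finset.univ : Finset (Equiv.Perm (Fin m))).card = m.factorial := by
    intro m
    rw [Finset.card_univ, Fintype.card_perm, Fintype.card_fin]
  rw [← hperm k, ← hperm n, ← Finset.card_product]
  refine Finset.card_le_card_of_injOn (fun p => p.1 * p.2.viaEmbedding ι)
    (fun _ _ => Finset.mem_coe.2 (Finset.mem_univ _)) ?_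
  rintro ⟨π, σ⟩ hπ ⟨τ, ρ⟩ hτ heq
  simp only [Finset.coe_product, Set.mem_prod, Finset.mem_coe, Finset.mem_filter,
    Finset.mem_univ, true_and, and_true] at hπ hτ
  obtain ⟨-, -, hdisj, hπ⟩ := hπ
  obtain ⟨-, -, -, hτ⟩ := hτ
  simp only at heq
  have on_g : ∀ a, π (g (σ a)) = τ (g (ρ a)) := by
    intro a
    have := DFunLike.congr_fun heq (ι a)
    simp only [Equiv.Perm.mul_apply, Equiv.Perm.viaEmbedding_apply] at this
    exact this
  have on_f : ∀ a, π (f a) = τ (f a) := by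
    intro a
    have hnot : f a ∉ Set.range ι := by
      rintro ⟨b, hb⟩
      exact hdisj a b hb.symm
    have := DFunLike.congr_fun heq (f a)
    simpa only [Equiv.Perm.mul_apply, Equiv.Perm.viaEmbedding_apply_of_notMem _ _ _ hnot]
      using this
  have hone : ρ * σ⁻¹ = 1 := by
    refine perm_eq_one_of_lt_iff_lt (u := fun a => τ (g a)) (τ.injective.comp hg.injective) _ ?_
    intro a b
    have h : ∀ c, τ (g ((ρ * σ⁻¹) c)) = π (g c) := by
      intro c
      rw [Equiv.Perm.mul_apply, ← on_g]
      simp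
    rw [h, h, ← hπ, ← hτ, on_f, on_f]
  obtain rfl : ρ = σ := mul_inv_eq_one.1 hone
  exact Prod.ext (mul_right_cancel heq) rfl

/-- There are at most `n.choose k` increasing sequences of length `k` in `Fin n`. -/
lemma card_orderEmbedding_fin_le_choose (n k : ℕ) :
    Nat.card (Fin k ↪o Fin n) ≤ n.choose k := by
  have hcard : Nat.card {s : Finset (Fin n) // s.card = k} = n.choose k := by
    rw [Nat.card_eq_fintype_card, Fintype.card_finset_len, Fintype.card_fin]
  rw [← hcard]
  refine Nat.card_le_card_of_injective
    (fun f : Fin k ↪o Fin n => (⟨Finset.univ.map f.toEmbedding, by simp⟩ :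
      {s : Finset (Fin n) // s.card = k})) ?_
  intro f g hfg
  have hrange : Set.range f = Set.range g := by
    have := congrArg (fun s : {s : Finset (Fin n) // s.card = k} => (s.1 : Set (Fin n))) hfg
    simpa using this
  exact DFunLike.coe_injective
    ((StrictMono.range_inj f.strictMono g.strictMono).1 hrange)

open Classical in
/-- The union bound over all pairs of increasing position sequences. -/
lemma factorial_le_choose_sq_of_forall_hasTwins {n k : ℕ}
    (h : ∀ π : Equiv.Perm (Fin n), HasTwins π k) : k.factorial ≤ n.choose k ^ 2 := by
  let E := Fin k ↪o Fin n
  let bad : E × E → Finset (Equiv.Perm (Fin n)) :=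
    fun p => Finset.univ.filter fun π => IsTwinPair π p.1 p.2
  have hcover : (Finset.univ : Finset (Equiv.Perm (Fin n))) ⊆ Finset.univ.biUnion bad := by
    intro π _
    obtain ⟨f, g, hf, hg, hfg⟩ := h π
    refine Finset.mem_biUnion.2 ⟨(OrderEmbedding.ofStrictMono f hf,
      OrderEmbedding.ofStrictMono g hg), Finset.mem_univ _, ?_⟩
    exact Finset.mem_filter.2 ⟨Finset.mem_univ _, hf, hg, hfg⟩
  have hE : Fintype.card E ≤ n.choose k := by
    rw [← Nat.card_eq_fintype_card]
    exact card_orderEmbedding_fin_le_choose n k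
  refine Nat.le_of_mul_le_mul_left ?_ n.factorial_pos
  calc n.factorial * k.factorial
      = (Finset.univ : Finset (Equiv.Perm (Fin n))).card * k.factorial := by
        rw [Finset.card_univ, Fintype.card_perm, Fintype.card_fin]
    _ ≤ (∑ p, (bad p).card) * k.factorial := by
        gcongr
        exact (Finset.card_le_card hcover).trans Finset.card_biUnion_le
    _ = ∑ p, (bad p).card * k.factorial := Finset.sum_mul _ _ _
    _ ≤ ∑ _p : E × E, n.factorial :=
        Finset.sum_le_sum fun p _ => card_isTwinPair_mul_factorial_le p.1 p.2
    _ = n.factorial * Fintype.card E ^ 2 := by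
        rw [Finset.sum_const, Finset.card_univ, Fintype.card_prod, smul_eq_mul]
        ring
    _ ≤ n.factorial * n.choose k ^ 2 := by gcongr

/-- For every $n ≥ 1$ and every $k > e·n^{2/3}$ there is a permutation of $[n]$
with no pair of twins of length $k$; in particular $t(n) = O(n^{2/3})$. -/
theorem twins_upper_bound (n k : ℕ) (hn : 1 ≤ n)
    (hk : Real.exp 1 * (n : ℝ) ^ ((2 : ℝ) / 3) < (k : ℝ)) :
    ∃ π : Equiv.Perm (Fin n), ¬ HasTwins π k := by
  by_contra! hall
  have hk_pos : (0 : ℝ) < k := lt_of_le_of_lt (by positivity) hk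
  have hk_ne : k ≠ 0 := by
    rintro rfl
    simp at hk_pos
  have hfac : (0 : ℝ) < k.factorial := by exact_mod_cast k.factorial_pos
  have hunion : (k.factorial : ℝ) ≤ (n.choose k : ℝ) ^ 2 := by
    exact_mod_cast factorial_le_choose_sq_of_forall_hasTwins hall
  have hchoose : (n.choose k : ℝ) * k.factorial ≤ (n : ℝ) ^ k := by
    rw [← le_div_iff₀ hfac]
    exact Nat.choose_le_pow_div k n
  have hcube : (k.factorial : ℝ) ^ 3 ≤ ((n : ℝ) ^ 2) ^ k :=
    calc (k.factorial : ℝ) ^ 3 = k.factorial * (k.factorial : ℝ) ^ 2 := by ring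
      _ ≤ (n.choose k : ℝ) ^ 2 * (k.factorial : ℝ) ^ 2 := by gcongr
      _ = ((n.choose k : ℝ) * k.factorial) ^ 2 := by ring
      _ ≤ ((n : ℝ) ^ k) ^ 2 := by gcongr
      _ = ((n : ℝ) ^ 2) ^ k := by ring
  have hstirling : (k : ℝ) ^ k ≤ Real.exp 1 ^ k * k.factorial := by
    rw [← div_le_iff₀ hfac, ← Real.exp_nat_mul, mul_one]
    exact Real.pow_div_factorial_le_exp _ hk_pos.le k
  have hroot : ((n : ℝ) ^ ((2 : ℝ) / 3)) ^ 3 = (n : ℝ) ^ 2 := by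
    rw [← Real.rpow_natCast, ← Real.rpow_mul n.cast_nonneg, ← Real.rpow_natCast]
    norm_num
  have hlt : Real.exp 1 ^ 3 * (n : ℝ) ^ 2 < (k : ℝ) ^ 3 := by
    rw [← hroot, ← mul_pow]
    exact pow_lt_pow_left₀ hk (by positivity) (by norm_num)
  have hpow : (Real.exp 1 ^ 3 * (n : ℝ) ^ 2) ^ k < ((k : ℝ) ^ 3) ^ k :=
    pow_lt_pow_left₀ hlt (by positivity) hk_ne
  refine hpow.not_ge ?_
  calc ((k : ℝ) ^ 3) ^ k = ((k : ℝ) ^ k) ^ 3 := by ring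
    _ ≤ (Real.exp 1 ^ k * k.factorial) ^ 3 := by gcongr
    _ = (Real.exp 1 ^ 3) ^ k * (k.factorial : ℝ) ^ 3 := by ring
    _ ≤ (Real.exp 1 ^ 3) ^ k * ((n : ℝ) ^ 2) ^ k := by gcongr
    _ = (Real.exp 1 ^ 3 * (n : ℝ) ^ 2) ^ k := by rw [mul_pow]
end

section
/- There exists a constant c > 0 such that the proportion, among all n! permutations π of [n], of those satisfying t(π) ≥ c·n^{2/3}/(log n)^{1/3} tends to 1 as n → ∞. (That is, a uniformly random n-permutation asymptotically almost surely contains twins of length Ω(n^{2/3}/(log n)^{1/3}).) -/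
open Finset in
/-- The permutations extending a given partial injection `x i ↦ y i` on `k` points form a
fraction `1 / (n)_k` of all permutations. -/
theorem card_perm_extending {n k : ℕ} (x y : Fin k ↪ Fin n) :
    #{π : Equiv.Perm (Fin n) | ∀ i, π (x i) = y i} * n.descFactorial k = n.factorial := by
  have key : ∀ z : Fin k ↪ Fin n,
      #{π : Equiv.Perm (Fin n) | x.trans π.toEmbedding = z} =
        #{π : Equiv.Perm (Fin n) | ∀ i, π (x i) = y i} := by
    intro z
    have := Equiv.Perm.isMultiplyPretransitive (Fin n) k
    obtain ⟨σ, hσ⟩ := MulAction.exists_smul_eq (Equiv.Perm (Fin n)) z y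
    have hσ' : ∀ i, σ (z i) = y i := fun i => DFunLike.congr_fun hσ i
    refine Finset.card_equiv (Equiv.mulLeft σ) fun π => ?_
    simp only [mem_filter, mem_univ, true_and, Equiv.coe_mulLeft, Equiv.Perm.mul_apply]
    constructor
    · rintro rfl i
      exact hσ' i
    · intro h
      ext1 i
      apply σ.injective
      rw [hσ' i, ← h i]
      rfl
  have h := Finset.card_eq_sum_card_fiberwise (s := (univ : Finset (Equiv.Perm (Fin n))))
    (t := (univ : Finset (Fin k ↪ Fin n))) (f := fun π => x.trans π.toEmbedding)
    (fun _ _ => by simp)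
  rw [Finset.sum_congr rfl fun z _ => key z] at h
  simp only [sum_const, smul_eq_mul, card_univ, Fintype.card_perm, Fintype.card_embedding_eq,
    Fintype.card_fin] at h
  rw [h, mul_comm]

open Finset in
theorem sum_card_matches_eq {n k : ℕ} {ι κ : Type*} (A : Finset ι) (B : Finset κ)
    (x : ι → Fin k → Fin n) (y : κ → Fin k → Fin n)
    (hx : ∀ i ∈ A, Function.Injective (x i)) (hy : ∀ j ∈ B, Function.Injective (y j)) :
    (∑ π : Equiv.Perm (Fin n), #{p ∈ A ×ˢ B | ∀ l, π (x p.1 l) = y p.2 l}) * n.descFactorial k =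
      #A * #B * n.factorial := by
  simp only [card_filter]
  rw [sum_comm, sum_mul, ← card_product, ← smul_eq_mul, ← sum_const]
  refine sum_congr rfl fun p hp => ?_
  rw [mem_product] at hp
  rw [← card_filter]
  exact card_perm_extending ⟨x p.1, hx _ hp.1⟩ ⟨y p.2, hy _ hp.2⟩

open Finset in
theorem sum_card_matches_le {n k : ℕ} {ι κ : Type*} (A : Finset ι) (B : Finset κ)
    (x : ι → Fin k → Fin n) (y : κ → Fin k → Fin n)
    (hx : ∀ i ∈ A, Function.Injective (x i)) (P : Equiv.Perm (Fin n) → ι → Prop)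
    [∀ π, DecidablePred (P π)]
    (hP : ∀ π, ∀ i ∈ A, P π i → ∃ j ∈ B, ∀ l, π (x i l) = y j l) :
    (∑ π : Equiv.Perm (Fin n), #{i ∈ A | P π i}) * n.descFactorial k ≤
      #A * #B * n.factorial := by
  classical
  set B' := B.filter fun j => Function.Injective (y j) with hB'
  calc (∑ π : Equiv.Perm (Fin n), #{i ∈ A | P π i}) * n.descFactorial k
      ≤ (∑ π : Equiv.Perm (Fin n), #{p ∈ A ×ˢ B' | ∀ l, π (x p.1 l) = y p.2 l}) *
          n.descFactorial k := by
        gcongr with π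
        refine (card_le_card ?_).trans (card_image_le (f := Prod.fst))
        intro i hi
        obtain ⟨hi, hPi⟩ := mem_filter.1 hi
        obtain ⟨j, hj, h⟩ := hP π i hi hPi
        refine mem_image.2 ⟨(i, j), mem_filter.2 ⟨mem_product.2 ⟨hi, mem_filter.2 ⟨hj, ?_⟩⟩, h⟩, rfl⟩
        have : y j = π ∘ x i := funext fun l => (h l).symm
        rw [this]
        exact π.injective.comp (hx i hi)
    _ = #A * #B' * n.factorial :=
        sum_card_matches_eq A B' x y hx fun j hj => (mem_filter.1 hj).2
    _ ≤ #A * #B * n.factorial := by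
        gcongr
        exact filter_subset _ _

theorem lt_iff_lt_of_blocks {α : Type*} [LinearOrder α] {β : α → ℕ} (hβ : Monotone β)
    {x x' y y' : α} (hx : β x = β x') (hy : β y = β y') (hne : β x ≠ β y) :
    x < y ↔ x' < y' := by
  have h : ∀ {u v : α}, β u ≠ β v → (u < v ↔ β u < β v) := fun {u v} huv =>
    ⟨fun h => lt_of_le_of_ne (hβ h.le) huv, fun h => hβ.reflect_lt h⟩
  rw [h hne, h (hx ▸ hy ▸ hne), hx, hy]

theorem hasTwins_of_separated {n : ℕ} (π : Equiv.Perm (Fin n)) {β : Fin n → ℕ} (hβ : Monotone β)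
    (M : Finset (Fin n × Fin n))
    (hM : ∀ e ∈ M, e.1 < e.2 ∧ β e.1 = β e.2 ∧ β (π e.1) = β (π e.2))
    (hsep : ∀ e ∈ M, ∀ f ∈ M, e ≠ f → β e.1 ≠ β f.1 ∧ β (π e.1) ≠ β (π f.1)) :
    HasTwins π M.card := by
  have hinj : Set.InjOn Prod.fst (M : Set (Fin n × Fin n)) := by
    intro e he f hf hef
    by_contra hne
    exact (hsep e he f hf hne).1 (congrArg β hef)
  have hcard : (M.image Prod.fst).card = M.card := Finset.card_image_of_injOn hinj
  set f := (M.image Prod.fst).orderEmbOfFin hcard with hf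
  have hex : ∀ a, ∃ q, (f a, q) ∈ M := fun a => by
    obtain ⟨e, he, h⟩ := Finset.mem_image.1 (Finset.orderEmbOfFin_mem _ hcard a)
    exact ⟨e.2, by rw [hf, ← h]; exact he⟩
  choose g hg using hex
  have hs : ∀ {a b}, a ≠ b → β (f a) ≠ β (f b) ∧ β (π (f a)) ≠ β (π (f b)) := fun {a b} hab =>
    hsep _ (hg a) _ (hg b) fun h => hab (f.injective (congrArg Prod.fst h))
  refine ⟨f, g, f.strictMono, fun a b hab => ?_, fun a b h => ?_, fun a b => ?_⟩
  · exact (lt_iff_lt_of_blocks hβ (hM _ (hg a)).2.1 (hM _ (hg b)).2.1 (hs hab.ne).1).1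
      (f.strictMono hab)
  · rcases eq_or_ne a b with rfl | hab
    · exact (hM _ (hg a)).1.ne h
    · exact (hs hab).1 ((congrArg β h).trans (hM _ (hg b)).2.1.symm)
  · rcases eq_or_ne a b with rfl | hab
    · simp
    · exact lt_iff_lt_of_blocks hβ (hM _ (hg a)).2.2 (hM _ (hg b)).2.2 (hs hab).2

theorem HasTwins.le_twinLen {n k : ℕ} {π : Equiv.Perm (Fin n)} (h : HasTwins π k) :
    k ≤ twinLen π := by
  refine le_csSup ⟨n, ?_⟩ h
  rintro l ⟨f, -, hf, -⟩
  simpa using Fintype.card_le_of_injective f hf.injective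

/-- Increasing pairs of positions in the same block. -/
def blockPairs {n : ℕ} (β : Fin n → ℕ) : Finset (Fin n × Fin n) :=
  {e | e.1 < e.2 ∧ β e.1 = β e.2}

/-- Pairs of positions in the same block, whose values also lie in the same block. -/
def goodPairs {n : ℕ} (β : Fin n → ℕ) (π : Equiv.Perm (Fin n)) : Finset (Fin n × Fin n) :=
  {e ∈ blockPairs β | β (π e.1) = β (π e.2)}

/-- Two distinct good pairs sharing their position block or their value block. -/
def conflicts {n : ℕ} (β : Fin n → ℕ) (π : Equiv.Perm (Fin n)) :
    Finset ((Fin n × Fin n) × (Fin n × Fin n)) :=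
  {p ∈ (goodPairs β π).offDiag | β p.1.1 = β p.2.1 ∨ β (π p.1.1) = β (π p.2.1)}

/-- Triples of distinct positions in the same block. -/
def blockTriples {n : ℕ} (β : Fin n → ℕ) : Finset (Fin n × Fin n × Fin n) :=
  {t | t.1 ≠ t.2.1 ∧ t.1 ≠ t.2.2 ∧ t.2.1 ≠ t.2.2 ∧ β t.1 = β t.2.1 ∧ β t.1 = β t.2.2}

/-- Triples of distinct positions in the same block, whose values also lie in the same block. -/
def goodTriples {n : ℕ} (β : Fin n → ℕ) (π : Equiv.Perm (Fin n)) :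
    Finset (Fin n × Fin n × Fin n) :=
  {t ∈ blockTriples β | β (π t.1) = β (π t.2.1) ∧ β (π t.1) = β (π t.2.2)}

/-- Two disjoint pairs, each contained in a block. -/
def disjointBlockPairs {n : ℕ} (β : Fin n → ℕ) : Finset ((Fin n × Fin n) × (Fin n × Fin n)) :=
  {p ∈ blockPairs β ×ˢ blockPairs β |
    p.1.1 ≠ p.2.1 ∧ p.1.1 ≠ p.2.2 ∧ p.1.2 ≠ p.2.1 ∧ p.1.2 ≠ p.2.2}

/-- Two disjoint good pairs. -/
def disjointGoodPairs {n : ℕ} (β : Fin n → ℕ) (π : Equiv.Perm (Fin n)) :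
    Finset ((Fin n × Fin n) × (Fin n × Fin n)) :=
  {p ∈ disjointBlockPairs β | β (π p.1.1) = β (π p.1.2) ∧ β (π p.2.1) = β (π p.2.2)}

theorem card_goodPairs_le_twinLen_add {n : ℕ} (π : Equiv.Perm (Fin n)) {β : Fin n → ℕ}
    (hβ : Monotone β) : (goodPairs β π).card ≤ twinLen π + (conflicts β π).card := by
  set M := goodPairs β π \ (conflicts β π).image Prod.fst with hM
  have hM' : ∀ e ∈ M, e ∈ goodPairs β π := fun e he => (Finset.mem_sdiff.1 he).1
  have h : HasTwins π M.card := by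
    refine hasTwins_of_separated π hβ M (fun e he => ?_) fun e he f hf hef => ?_
    · have := hM' e he
      simp only [goodPairs, blockPairs, Finset.mem_filter, Finset.mem_univ, true_and] at this
      exact ⟨this.1.1, this.1.2, this.2⟩
    · have hc : (e, f) ∉ conflicts β π := fun hc =>
        (Finset.mem_sdiff.1 he).2 (Finset.mem_image_of_mem Prod.fst hc)
      simp only [conflicts, Finset.mem_filter, Finset.mem_offDiag] at hc
      exact not_or.1 fun h => hc ⟨⟨hM' e he, hM' f hf, hef⟩, h⟩
  have h1 : (goodPairs β π).card - ((conflicts β π).image Prod.fst).card ≤ M.card :=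
    Finset.le_card_sdiff _ _
  have h2 := h.le_twinLen
  have h3 : ((conflicts β π).image Prod.fst).card ≤ (conflicts β π).card := Finset.card_image_le
  omega

/-- Two distinct good pairs that share a point come from a good triple. -/
theorem card_intersecting_le {n : ℕ} (β : Fin n → ℕ) (π : Equiv.Perm (Fin n)) :
    ((goodPairs β π).offDiag.filter fun p =>
      ¬(p.1.1 ≠ p.2.1 ∧ p.1.1 ≠ p.2.2 ∧ p.1.2 ≠ p.2.1 ∧ p.1.2 ≠ p.2.2)).card ≤
      4 * (goodTriples β π).card := by
  set W := goodTriples β π with hW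
  let φ : Fin 4 → Fin n × Fin n × Fin n → (Fin n × Fin n) × (Fin n × Fin n) :=
    fun i t => ((t.1, t.2.1),
      ![(t.1, t.2.2), (t.2.2, t.1), (t.2.1, t.2.2), (t.2.2, t.2.1)] i)
  have hsub : ((goodPairs β π).offDiag.filter fun p =>
      ¬(p.1.1 ≠ p.2.1 ∧ p.1.1 ≠ p.2.2 ∧ p.1.2 ≠ p.2.1 ∧ p.1.2 ≠ p.2.2)) ⊆
      (Finset.univ : Finset (Fin 4)).biUnion fun i => W.image (φ i) := by
    rintro ⟨⟨a, b⟩, ⟨c, d⟩⟩ hp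
    simp only [Finset.mem_filter, Finset.mem_offDiag, goodPairs, blockPairs, Finset.mem_univ,
      true_and, ne_eq, Prod.mk.injEq] at hp
    obtain ⟨⟨⟨⟨hab, hab1⟩, hab2⟩, ⟨⟨hcd, hcd1⟩, hcd2⟩, hne⟩, hsh⟩ := hp
    have hab' := hab.ne
    have hcd' := hcd.ne
    simp only [Finset.mem_biUnion, Finset.mem_univ, true_and, Finset.mem_image, hW, goodTriples,
      blockTriples, Finset.mem_filter, φ]
    by_cases h1 : a = c
    · exact ⟨0, (a, b, d), by grind, by simp [h1]⟩
    by_cases h2 : a = d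
    · exact ⟨1, (a, b, c), by grind, by simp [h2]⟩
    by_cases h3 : b = c
    · exact ⟨2, (a, b, d), by grind, by simp [h3]⟩
    by_cases h4 : b = d
    · exact ⟨3, (a, b, c), by grind, by simp [h4]⟩
    grind
  refine (Finset.card_le_card hsub).trans (Finset.card_biUnion_le.trans ?_)
  refine (Finset.sum_le_sum fun i _ => Finset.card_image_le).trans ?_
  simp

theorem card_goodPairs_sq_le {n : ℕ} (β : Fin n → ℕ) (π : Equiv.Perm (Fin n)) :
    (goodPairs β π).card ^ 2 ≤
      (goodPairs β π).card + 4 * (goodTriples β π).card + (disjointGoodPairs β π).card := by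
  have h1 := Finset.card_filter_add_card_filter_not (s := (goodPairs β π).offDiag) (fun p =>
    p.1.1 ≠ p.2.1 ∧ p.1.1 ≠ p.2.2 ∧ p.1.2 ≠ p.2.1 ∧ p.1.2 ≠ p.2.2)
  have h2 := card_intersecting_le β π
  have h3 : ((goodPairs β π).offDiag.filter fun p =>
      p.1.1 ≠ p.2.1 ∧ p.1.1 ≠ p.2.2 ∧ p.1.2 ≠ p.2.1 ∧ p.1.2 ≠ p.2.2).card ≤
      (disjointGoodPairs β π).card := by
    refine Finset.card_le_card fun p => ?_
    simp only [Finset.mem_filter, Finset.mem_offDiag, goodPairs, disjointGoodPairs,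
      disjointBlockPairs, Finset.mem_product]
    tauto
  have h4 : (goodPairs β π).card ^ 2 = (goodPairs β π).offDiag.card + (goodPairs β π).card := by
    rw [Finset.offDiag_card, sq, Nat.sub_add_cancel (Nat.le_mul_self _)]
  omega

theorem card_conflicts_le {n : ℕ} (β : Fin n → ℕ) (π : Equiv.Perm (Fin n)) :
    (conflicts β π).card ≤ 4 * (goodTriples β π).card +
      ({p ∈ disjointGoodPairs β π | β p.1.1 = β p.2.1}).card +
      ({p ∈ disjointGoodPairs β π | β (π p.1.1) = β (π p.2.1)}).card := by
  refine le_trans (Finset.card_le_card (t := ((goodPairs β π).offDiag.filter fun p =>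
      ¬(p.1.1 ≠ p.2.1 ∧ p.1.1 ≠ p.2.2 ∧ p.1.2 ≠ p.2.1 ∧ p.1.2 ≠ p.2.2)) ∪
      {p ∈ disjointGoodPairs β π | β p.1.1 = β p.2.1} ∪
      {p ∈ disjointGoodPairs β π | β (π p.1.1) = β (π p.2.1)}) fun p => ?_) ?_
  · simp only [conflicts, Finset.mem_union, Finset.mem_filter, Finset.mem_offDiag, goodPairs,
      disjointGoodPairs, disjointBlockPairs, Finset.mem_product]
    tauto
  · refine (Finset.card_union_le _ _).trans (Nat.add_le_add_right ?_ _)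
    refine (Finset.card_union_le _ _).trans (Nat.add_le_add_right ?_ _)
    exact card_intersecting_le β π

/-- Ordered pairs of distinct elements in the same block. -/
def orderedBlockPairs {n : ℕ} (β : Fin n → ℕ) : Finset (Fin n × Fin n) :=
  {e | e.1 ≠ e.2 ∧ β e.1 = β e.2}

theorem sum_card_goodPairs {n : ℕ} (β : Fin n → ℕ) :
    (∑ π : Equiv.Perm (Fin n), (goodPairs β π).card) * n.descFactorial 2 =
      (blockPairs β).card * (orderedBlockPairs β).card * n.factorial := by
  rw [← sum_card_matches_eq (k := 2) (blockPairs β) (orderedBlockPairs β)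
    (fun e => ![e.1, e.2]) (fun e => ![e.1, e.2])]
  · congr 1
    refine Finset.sum_congr rfl fun π _ => ?_
    refine Finset.card_nbij' (fun e => (e, (π e.1, π e.2))) Prod.fst ?_ ?_ ?_ ?_
    · intro e he
      simp only [goodPairs, blockPairs, Finset.coe_filter, Set.mem_ofPred_eq, Finset.mem_filter,
        Finset.mem_univ, true_and, Finset.mem_product, orderedBlockPairs] at he ⊢
      exact ⟨⟨he.1, π.injective.ne he.1.1.ne, he.2⟩, by simp [Fin.forall_fin_two]⟩
    · rintro ⟨e, f⟩ he
      simp only [goodPairs, Finset.coe_filter, Set.mem_ofPred_eq, Finset.mem_filter,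
        Finset.mem_product, orderedBlockPairs, Fin.forall_fin_two] at he ⊢
      simp at he
      exact ⟨he.1.1, by rw [he.2.1, he.2.2]; exact he.1.2.2⟩
    · intro e _
      rfl
    · rintro ⟨e, f⟩ he
      simp [Fin.forall_fin_two] at he
      simp [he.2.1, he.2.2]
  · intro e he
    simp only [blockPairs, Finset.mem_filter] at he
    intro i j
    fin_cases i <;> fin_cases j <;> simp <;> grind
  · intro e he
    simp only [orderedBlockPairs, Finset.mem_filter] at he
    intro i j
    fin_cases i <;> fin_cases j <;> simp <;> grind

/-- Triples of elements in the same block. -/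
def weakBlockTriples {n : ℕ} (β : Fin n → ℕ) : Finset (Fin n × Fin n × Fin n) :=
  {t | β t.1 = β t.2.1 ∧ β t.1 = β t.2.2}

theorem sum_card_goodTriples_le {n : ℕ} (β : Fin n → ℕ) :
    (∑ π : Equiv.Perm (Fin n), (goodTriples β π).card) * n.descFactorial 3 ≤
      (weakBlockTriples β).card * (weakBlockTriples β).card * n.factorial := by
  refine (sum_card_matches_le (k := 3) (blockTriples β) (weakBlockTriples β)
    (fun e => ![e.1, e.2.1, e.2.2]) (fun e => ![e.1, e.2.1, e.2.2]) ?_ _ ?_).trans ?_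
  · intro e he
    simp only [blockTriples, Finset.mem_filter] at he
    intro i j
    fin_cases i <;> fin_cases j <;> simp <;> grind
  · intro π e _ h
    refine ⟨(π e.1, π e.2.1, π e.2.2), by simpa [weakBlockTriples] using h, ?_⟩
    intro i
    fin_cases i <;> rfl
  · gcongr
    intro e
    simp only [blockTriples, weakBlockTriples, Finset.mem_filter]
    tauto

/-- A bound for the number of disjoint good pairs in a set `A` whose values lie in `S`. -/
theorem sum_card_disjoint_le {n : ℕ} (β : Fin n → ℕ)
    (A : Finset ((Fin n × Fin n) × (Fin n × Fin n))) (hA : A ⊆ disjointBlockPairs β)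
    (S : Finset ((Fin n × Fin n) × (Fin n × Fin n))) :
    (∑ π : Equiv.Perm (Fin n),
      (A.filter fun p => ((π p.1.1, π p.1.2), (π p.2.1, π p.2.2)) ∈ S).card) *
        n.descFactorial 4 ≤ A.card * S.card * n.factorial := by
  refine sum_card_matches_le (k := 4) A S
    (fun e => ![e.1.1, e.1.2, e.2.1, e.2.2]) (fun e => ![e.1.1, e.1.2, e.2.1, e.2.2]) ?_ _ ?_
  · intro e he
    have := hA he
    simp only [disjointBlockPairs, blockPairs, Finset.mem_filter, Finset.mem_product] at this
    intro i j
    fin_cases i <;> fin_cases j <;> simp <;> grind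
  · intro π e _ h
    refine ⟨_, h, ?_⟩
    intro i
    fin_cases i <;> rfl

/-- Pairs of same-block pairs, all four elements in the same block. -/
def blockQuadruples {n : ℕ} (β : Fin n → ℕ) : Finset ((Fin n × Fin n) × (Fin n × Fin n)) :=
  {p | β p.1.1 = β p.1.2 ∧ β p.2.1 = β p.2.2 ∧ β p.1.1 = β p.2.1}

theorem sum_card_disjointGoodPairs_le {n : ℕ} (β : Fin n → ℕ) :
    (∑ π : Equiv.Perm (Fin n), (disjointGoodPairs β π).card) * n.descFactorial 4 ≤
      (blockPairs β).card ^ 2 * (orderedBlockPairs β).card ^ 2 * n.factorial := by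
  refine le_trans (Nat.mul_le_mul_right _ (Finset.sum_le_sum fun π _ => Finset.card_le_card ?_))
    ((sum_card_disjoint_le β _ subset_rfl (orderedBlockPairs β ×ˢ orderedBlockPairs β)).trans ?_)
  · intro p
    simp only [disjointGoodPairs, disjointBlockPairs, blockPairs, orderedBlockPairs,
      Finset.mem_filter, Finset.mem_product, Finset.mem_univ, true_and, ne_eq,
      EmbeddingLike.apply_eq_iff_eq]
    grind
  · rw [Finset.card_product, ← sq]
    gcongr
    rw [sq, ← Finset.card_product]
    exact Finset.card_le_card (Finset.filter_subset _ _)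

theorem sum_card_disjoint_same_position_block_le {n : ℕ} (β : Fin n → ℕ) :
    (∑ π : Equiv.Perm (Fin n),
      ({p ∈ disjointGoodPairs β π | β p.1.1 = β p.2.1}).card) * n.descFactorial 4 ≤
      (blockQuadruples β).card * (orderedBlockPairs β).card ^ 2 * n.factorial := by
  refine le_trans (Nat.mul_le_mul_right _ (Finset.sum_le_sum fun π _ => Finset.card_le_card ?_))
    ((sum_card_disjoint_le β {p ∈ disjointBlockPairs β | β p.1.1 = β p.2.1}
      (Finset.filter_subset _ _) (orderedBlockPairs β ×ˢ orderedBlockPairs β)).trans ?_)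
  · intro p
    simp only [disjointGoodPairs, disjointBlockPairs, blockPairs, orderedBlockPairs,
      Finset.mem_filter, Finset.mem_product, Finset.mem_univ, true_and, ne_eq,
      EmbeddingLike.apply_eq_iff_eq]
    grind
  · rw [Finset.card_product, ← sq]
    gcongr
    intro p
    simp only [disjointBlockPairs, blockPairs, blockQuadruples,
      Finset.mem_filter, Finset.mem_product, Finset.mem_univ, true_and]
    tauto

theorem sum_card_disjoint_same_value_block_le {n : ℕ} (β : Fin n → ℕ) :
    (∑ π : Equiv.Perm (Fin n),
      ({p ∈ disjointGoodPairs β π | β (π p.1.1) = β (π p.2.1)}).card) * n.descFactorial 4 ≤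
      (blockQuadruples β).card * (orderedBlockPairs β).card ^ 2 * n.factorial := by
  refine le_trans (Nat.mul_le_mul_right _ (Finset.sum_le_sum fun π _ => Finset.card_le_card ?_))
    ((sum_card_disjoint_le β _ subset_rfl (blockQuadruples β)).trans ?_)
  · intro p
    simp only [disjointGoodPairs, blockQuadruples, Finset.mem_filter, Finset.mem_univ, true_and]
    tauto
  · refine Nat.mul_le_mul_right _ ?_
    rw [mul_comm]
    refine Nat.mul_le_mul_left _ ?_
    rw [sq, ← Finset.card_product]
    refine Finset.card_le_card fun p => ?_
    simp only [disjointBlockPairs, blockPairs, orderedBlockPairs, Finset.mem_filter,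
      Finset.mem_product, Finset.mem_univ, true_and]
    grind

/-- The index of the block of `B` consecutive elements containing `a`. -/
def blockIndex {n : ℕ} (B : ℕ) (a : Fin n) : ℕ := a / B

theorem blockIndex_monotone {n : ℕ} (B : ℕ) : Monotone (blockIndex B : Fin n → ℕ) :=
  fun _ _ h => Nat.div_le_div_right h

theorem eq_of_blockIndex_eq {n B : ℕ} {a b : Fin n} (h : blockIndex B a = blockIndex B b)
    (h' : (a : ℕ) % B = b % B) : a = b := by
  rw [Fin.ext_iff, ← Nat.div_add_mod a B, ← Nat.div_add_mod b B, h']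
  unfold blockIndex at h
  rw [h]

theorem card_orderedBlockPairs_le {n B : ℕ} (hB : 0 < B) :
    (orderedBlockPairs (blockIndex B : Fin n → ℕ)).card ≤ n * B := by
  calc _ ≤ ((Finset.univ : Finset (Fin n)) ×ˢ Finset.range B).card := by
        refine Finset.card_le_card_of_injOn (fun e => (e.1, (e.2 : ℕ) % B)) ?_ ?_
        · intro e _
          simp [Nat.mod_lt _ hB]
        · rintro ⟨a, b⟩ he ⟨c, d⟩ hf h
          simp only [orderedBlockPairs, Finset.coe_filter, Finset.mem_univ, true_and,
            Set.mem_ofPred_eq, Prod.mk.injEq] at he hf h ⊢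
          obtain ⟨rfl, h⟩ := h
          exact ⟨rfl, eq_of_blockIndex_eq (he.2.symm.trans hf.2) h⟩
    _ = n * B := by simp

theorem card_weakBlockTriples_le {n B : ℕ} (hB : 0 < B) :
    (weakBlockTriples (blockIndex B : Fin n → ℕ)).card ≤ n * B ^ 2 := by
  calc _ ≤ ((Finset.univ : Finset (Fin n)) ×ˢ Finset.range B ×ˢ Finset.range B).card := by
        refine Finset.card_le_card_of_injOn
          (fun e => (e.1, (e.2.1 : ℕ) % B, (e.2.2 : ℕ) % B)) ?_ ?_
        · intro e _
          simp [Nat.mod_lt _ hB]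
        · rintro ⟨a, b, c⟩ he ⟨a', b', c'⟩ hf h
          simp only [weakBlockTriples, Finset.coe_filter, Finset.mem_univ, true_and,
            Set.mem_ofPred_eq, Prod.mk.injEq] at he hf h ⊢
          obtain ⟨rfl, h, h'⟩ := h
          exact ⟨rfl, eq_of_blockIndex_eq (he.1.symm.trans hf.1) h,
            eq_of_blockIndex_eq (he.2.symm.trans hf.2) h'⟩
    _ = n * B ^ 2 := by simp [sq]

theorem card_blockQuadruples_le {n B : ℕ} (hB : 0 < B) :
    (blockQuadruples (blockIndex B : Fin n → ℕ)).card ≤ n * B ^ 3 := by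
  calc _ ≤ ((Finset.univ : Finset (Fin n)) ×ˢ
          Finset.range B ×ˢ Finset.range B ×ˢ Finset.range B).card := by
        refine Finset.card_le_card_of_injOn
          (fun e => (e.1.1, (e.1.2 : ℕ) % B, (e.2.1 : ℕ) % B, (e.2.2 : ℕ) % B)) ?_ ?_
        · intro e _
          simp [Nat.mod_lt _ hB]
        · rintro ⟨⟨a, b⟩, c, d⟩ he ⟨⟨a', b'⟩, c', d'⟩ hf h
          simp only [blockQuadruples, Finset.coe_filter, Finset.mem_univ, true_and,
            Set.mem_ofPred_eq, Prod.mk.injEq] at he hf h ⊢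
          obtain ⟨rfl, h, h', h''⟩ := h
          have hb := eq_of_blockIndex_eq (he.1.symm.trans hf.1) h
          have hc := eq_of_blockIndex_eq (he.2.2.symm.trans hf.2.2) h'
          subst hc
          exact ⟨⟨rfl, hb⟩, rfl, eq_of_blockIndex_eq (he.2.1.symm.trans hf.2.1) h''⟩
    _ = n * B ^ 3 := by
        simp only [Finset.card_product, Finset.card_univ, Fintype.card_fin, Finset.card_range]
        ring

theorem card_blockPairs_le_card_orderedBlockPairs {n : ℕ} (β : Fin n → ℕ) :
    (blockPairs β).card ≤ (orderedBlockPairs β).card := by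
  refine Finset.card_le_card fun e => ?_
  simp only [blockPairs, orderedBlockPairs, Finset.mem_filter, Finset.mem_univ, true_and]
  exact fun h => ⟨h.1.ne, h.2⟩

theorem mul_sq_le_card_blockPairs {n h m : ℕ} (hm : m * (2 * h) ≤ n) :
    m * h ^ 2 ≤ (blockPairs (blockIndex (2 * h) : Fin n → ℕ)).card := by
  have hlt : ∀ (i : Fin m) (s : ℕ), s < 2 * h → 2 * h * i + s < n := fun i s hs => by
    have : (i + 1 : ℕ) * (2 * h) ≤ m * (2 * h) := Nat.mul_le_mul_right _ i.2
    linarith [mul_comm (2 * h) (i : ℕ)]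
  have hdiv : ∀ i s : ℕ, s < 2 * h → (2 * h * i + s) / (2 * h) = i := fun i s hs => by
    rw [Nat.mul_add_div (by omega), Nat.div_eq_of_lt hs, add_zero]
  calc m * h ^ 2 = (Finset.univ : Finset (Fin m × Fin h × Fin h)).card := by simp [sq]
    _ ≤ _ := by
      refine Finset.card_le_card_of_injOn (fun t =>
        (⟨2 * h * t.1 + t.2.1, hlt _ _ (by omega)⟩,
          ⟨2 * h * t.1 + (h + t.2.2), hlt _ _ (by omega)⟩)) ?_ ?_
      · rintro ⟨i, s, t⟩ -
        rw [Finset.mem_coe, blockPairs, Finset.mem_filter]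
        refine ⟨Finset.mem_univ _, Fin.mk_lt_mk.2 (by omega), ?_⟩
        simp only [blockIndex]
        rw [hdiv _ _ (by omega), hdiv _ _ (by omega)]
      · rintro ⟨i, s, t⟩ - ⟨i', s', t'⟩ - heq
        simp only [Prod.mk.injEq, Fin.mk.injEq] at heq
        have hi : (i : ℕ) = i' := by
          rw [← hdiv i s (by omega), ← hdiv i' s' (by omega), heq.1]
        obtain ⟨h1, h2⟩ := heq
        rw [hi] at h1 h2
        simp only [Prod.mk.injEq, Fin.ext_iff]
        omega

/-- A second moment bound for `X` combined with a first moment bound for `C`: the difference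
`X - C` is rarely much smaller than the mean `μ` of `X`. -/
theorem card_sub_lt_quarter_mean_le {Ω : Type*} [Fintype Ω] (X C : Ω → ℝ) (hC : ∀ ω, 0 ≤ C ω)
    {μ v γ : ℝ} (hμ : 0 < μ) (hX : ∑ ω, X ω = μ * Fintype.card Ω)
    (hX2 : ∑ ω, X ω ^ 2 ≤ (μ ^ 2 + v) * Fintype.card Ω)
    (hCs : ∑ ω, C ω ≤ γ * Fintype.card Ω) :
    ((Finset.univ.filter fun ω => X ω - C ω < μ / 4).card : ℝ) ≤
      (4 * v / μ ^ 2 + 4 * γ / μ) * Fintype.card Ω := by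
  have hvar : ∑ ω, (X ω - μ) ^ 2 ≤ v * Fintype.card Ω := by
    have h : ∑ ω, (X ω - μ) ^ 2 =
        ∑ ω, X ω ^ 2 - 2 * μ * ∑ ω, X ω + Fintype.card Ω * μ ^ 2 := by
      rw [Finset.mul_sum, ← Finset.sum_sub_distrib, ← nsmul_eq_mul, ← Finset.card_univ,
        ← Finset.sum_const, ← Finset.sum_add_distrib]
      exact Finset.sum_congr rfl fun ω _ => by ring
    rw [h, hX]
    linarith
  calc ((Finset.univ.filter fun ω => X ω - C ω < μ / 4).card : ℝ)
      = ∑ ω with X ω - C ω < μ / 4, (1 : ℝ) := by simp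
    _ ≤ ∑ ω with X ω - C ω < μ / 4, (4 / μ ^ 2 * (X ω - μ) ^ 2 + 4 / μ * C ω) := by
        refine Finset.sum_le_sum fun ω hω => ?_
        have hω := (Finset.mem_filter.1 hω).2
        rcases le_total (μ / 4) (C ω) with h | h
        · have h1 : 1 ≤ 4 / μ * C ω := by
            rw [div_mul_eq_mul_div, le_div_iff₀ hμ]
            linarith
          have : 0 ≤ 4 / μ ^ 2 * (X ω - μ) ^ 2 := by positivity
          linarith
        · have h1 : 1 ≤ 4 / μ ^ 2 * (X ω - μ) ^ 2 := by
            rw [div_mul_eq_mul_div, le_div_iff₀ (by positivity)]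
            nlinarith
          have : 0 ≤ 4 / μ * C ω := mul_nonneg (by positivity) (hC ω)
          linarith
    _ ≤ ∑ ω, (4 / μ ^ 2 * (X ω - μ) ^ 2 + 4 / μ * C ω) := by
        refine Finset.sum_le_sum_of_subset_of_nonneg (Finset.filter_subset _ _) fun ω _ _ => ?_
        exact add_nonneg (by positivity) (mul_nonneg (by positivity) (hC ω))
    _ = 4 / μ ^ 2 * ∑ ω, (X ω - μ) ^ 2 + 4 / μ * ∑ ω, C ω := by
        rw [Finset.sum_add_distrib, Finset.mul_sum, Finset.mul_sum]
    _ ≤ 4 / μ ^ 2 * (v * Fintype.card Ω) + 4 / μ * (γ * Fintype.card Ω) := by gcongr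
    _ = _ := by ring

theorem cube_le_mul_descFactorial_three {n : ℕ} (hn : 6 ≤ n) :
    (n : ℝ) ^ 3 ≤ 8 * (n.descFactorial 3 : ℝ) := by
  obtain ⟨k, rfl⟩ := Nat.exists_eq_add_of_le hn
  have h : (6 + k).descFactorial 3 = (4 + k) * ((5 + k) * (6 + k)) := by
    simp only [Nat.descFactorial_succ, Nat.descFactorial_zero]
    grind
  rw [h]
  push_cast
  have : (0 : ℝ) ≤ k := k.cast_nonneg
  nlinarith [pow_nonneg this 2, pow_nonneg this 3]

theorem pow_four_le_mul_descFactorial_four {n : ℕ} (hn : 6 ≤ n) :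
    (n : ℝ) ^ 4 ≤ 16 * (n.descFactorial 4 : ℝ) := by
  obtain ⟨k, rfl⟩ := Nat.exists_eq_add_of_le hn
  have h : (6 + k).descFactorial 4 = (3 + k) * ((4 + k) * ((5 + k) * (6 + k))) := by
    simp only [Nat.descFactorial_succ, Nat.descFactorial_zero]
    grind
  rw [h]
  push_cast
  have : (0 : ℝ) ≤ k := k.cast_nonneg
  nlinarith [pow_nonneg this 2, pow_nonneg this 3, pow_nonneg this 4]

theorem descFactorial_two_sq_le {n : ℕ} (hn : 6 ≤ n) :
    (n.descFactorial 2 : ℝ) ^ 2 ≤ (1 + 16 / n) * (n.descFactorial 4 : ℝ) := by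
  obtain ⟨k, rfl⟩ := Nat.exists_eq_add_of_le hn
  have h : (6 + k).descFactorial 4 = (3 + k) * ((4 + k) * ((5 + k) * (6 + k))) := by
    simp only [Nat.descFactorial_succ, Nat.descFactorial_zero]
    grind
  have h2 : (6 + k).descFactorial 2 = (5 + k) * (6 + k) := by
    simp only [Nat.descFactorial_succ, Nat.descFactorial_zero]
    grind
  rw [h, h2]
  push_cast
  have hk : (0 : ℝ) ≤ k := k.cast_nonneg
  have h0 : (0 : ℝ) < 6 + k := by linarith
  rw [one_add_div h0.ne', div_mul_eq_mul_div, le_div_iff₀ h0]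
  have key : (5 + k : ℝ) * (6 + k) ^ 2 ≤ (6 + k + 16) * ((3 + k) * (4 + k)) := by
    nlinarith [pow_nonneg hk 2, pow_nonneg hk 3]
  have hp : (0 : ℝ) ≤ (5 + k) * (6 + k) := by positivity
  calc ((5 + k : ℝ) * (6 + k : ℝ)) ^ 2 * (6 + k : ℝ)
      = (5 + k : ℝ) * (6 + k : ℝ) ^ 2 * ((5 + k : ℝ) * (6 + k : ℝ)) := by ring
    _ ≤ (6 + k + 16 : ℝ) * ((3 + k : ℝ) * (4 + k : ℝ)) * ((5 + k : ℝ) * (6 + k : ℝ)) :=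
        mul_le_mul_of_nonneg_right key hp
    _ = _ := by ring

/-- With blocks of length `2 * h`, a random permutation has twins of length `h ^ 2 / 64`, up to
an explicit exceptional proportion. -/
theorem card_twinLen_lt_le {n h : ℕ} (hn : 6 ≤ n) (hh : 1 ≤ h) (hhn : 4 * h ≤ n) :
    (Nat.card {π : Equiv.Perm (Fin n) // (twinLen π : ℝ) < (h : ℝ) ^ 2 / 64} : ℝ) ≤
      (64 / (h : ℝ) ^ 2 + 600000 / n + 100000 * ((h : ℝ) ^ 3 / n)) * n.factorial := by
  classical
  set β : Fin n → ℕ := blockIndex (2 * h) with hβ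
  have hB : 0 < 2 * h := by omega
  have hF : (0 : ℝ) < n.factorial := by exact_mod_cast n.factorial_pos
  have hn0 : (0 : ℝ) < n := by exact_mod_cast (by omega : 0 < n)
  have hh1 : (1 : ℝ) ≤ h := by exact_mod_cast hh
  have hh0 : (0 : ℝ) < h := by linarith
  have hd2 : (0 : ℝ) < n.descFactorial 2 := by
    exact_mod_cast Nat.pos_of_ne_zero (by rw [Ne, Nat.descFactorial_eq_zero_iff_lt]; omega)
  have hd3 : (0 : ℝ) < n.descFactorial 3 := by
    exact_mod_cast Nat.pos_of_ne_zero (by rw [Ne, Nat.descFactorial_eq_zero_iff_lt]; omega)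
  have hd4 : (0 : ℝ) < n.descFactorial 4 := by
    exact_mod_cast Nat.pos_of_ne_zero (by rw [Ne, Nat.descFactorial_eq_zero_iff_lt]; omega)
  set N : ℝ := ((blockPairs β).card : ℝ) with hN
  set Q : ℝ := ((orderedBlockPairs β).card : ℝ) with hQ
  set μ : ℝ := N * Q / n.descFactorial 2 with hμ
  have hN_lower : (n : ℝ) * h / 4 ≤ N := by
    have h1 : n / (2 * h) * h ^ 2 ≤ (blockPairs β).card :=
      mul_sq_le_card_blockPairs (Nat.div_mul_le_self n (2 * h))
    have h2 : n ≤ n / (2 * h) * (4 * h) := by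
      have h3 := Nat.lt_div_mul_add (a := n) hB
      have h4 : 2 ≤ n / (2 * h) := (Nat.le_div_iff_mul_le hB).2 (by linarith)
      nlinarith
    have h1' : ((n / (2 * h) : ℕ) : ℝ) * (h : ℝ) ^ 2 ≤ N := by
      rw [hN]
      exact_mod_cast h1
    have h2' : (n : ℝ) ≤ ((n / (2 * h) : ℕ) : ℝ) * (4 * h) := by exact_mod_cast h2
    nlinarith
  have hNQ : N ≤ Q := by
    rw [hN, hQ]
    exact_mod_cast card_blockPairs_le_card_orderedBlockPairs β
  have hQ_upper : Q ≤ n * (2 * h) := by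
    rw [hQ]
    exact_mod_cast card_orderedBlockPairs_le hB
  have hd2n : (n.descFactorial 2 : ℝ) ≤ (n : ℝ) ^ 2 := by
    exact_mod_cast Nat.descFactorial_le_pow n 2
  have hN0 : 0 < N := lt_of_lt_of_le (by positivity) hN_lower
  have hQ0 : 0 < Q := lt_of_lt_of_le hN0 hNQ
  have hμ_lower : (h : ℝ) ^ 2 / 16 ≤ μ := by
    rw [hμ, le_div_iff₀ hd2]
    calc (h : ℝ) ^ 2 / 16 * n.descFactorial 2 ≤ (h : ℝ) ^ 2 / 16 * (n : ℝ) ^ 2 := by gcongr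
      _ = ((n : ℝ) * h / 4) * ((n : ℝ) * h / 4) := by ring
      _ ≤ N * Q := by
        gcongr
        exact hN_lower.trans hNQ
  have hμ0 : 0 < μ := lt_of_lt_of_le (by positivity) hμ_lower
  have hX : ∑ π : Equiv.Perm (Fin n), ((goodPairs β π).card : ℝ) = μ * n.factorial := by
    rw [hμ, div_mul_eq_mul_div, eq_div_iff hd2.ne', hN, hQ]
    exact_mod_cast sum_card_goodPairs β
  have hT : ∑ π : Equiv.Perm (Fin n), ((goodTriples β π).card : ℝ) ≤
      128 * h ^ 4 / n * n.factorial := by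
    have h1 : (∑ π : Equiv.Perm (Fin n), ((goodTriples β π).card : ℝ)) * n.descFactorial 3 ≤
        (weakBlockTriples β).card * (weakBlockTriples β).card * n.factorial := by
      exact_mod_cast sum_card_goodTriples_le β
    have h2 : ((weakBlockTriples β).card : ℝ) ≤ n * (2 * h) ^ 2 := by
      exact_mod_cast card_weakBlockTriples_le hB
    refine le_of_mul_le_mul_right (h1.trans ?_) hd3
    calc ((weakBlockTriples β).card : ℝ) * (weakBlockTriples β).card * n.factorial
        ≤ (n * (2 * h) ^ 2) * (n * (2 * h) ^ 2) * n.factorial := by gcongr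
      _ = 16 * h ^ 4 / n * n.factorial * (n : ℝ) ^ 3 := by field_simp; ring
      _ ≤ 16 * h ^ 4 / n * n.factorial * (8 * (n.descFactorial 3 : ℝ)) := by
          gcongr
          exact cube_le_mul_descFactorial_three hn
      _ = _ := by ring
  have hD : ∑ π : Equiv.Perm (Fin n), ((disjointGoodPairs β π).card : ℝ) ≤
      (1 + 16 / n) * μ ^ 2 * n.factorial := by
    have h1 : (∑ π : Equiv.Perm (Fin n), ((disjointGoodPairs β π).card : ℝ)) *
        n.descFactorial 4 ≤ N ^ 2 * Q ^ 2 * n.factorial := by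
      rw [hN, hQ]
      exact_mod_cast sum_card_disjointGoodPairs_le β
    refine le_of_mul_le_mul_right (h1.trans ?_) hd4
    calc N ^ 2 * Q ^ 2 * n.factorial = μ ^ 2 * n.factorial * (n.descFactorial 2 : ℝ) ^ 2 := by
          rw [hμ]; field_simp
      _ ≤ μ ^ 2 * n.factorial * ((1 + 16 / n) * (n.descFactorial 4 : ℝ)) := by
          gcongr
          exact descFactorial_two_sq_le hn
      _ = _ := by ring
  have hquad : ((blockQuadruples β).card : ℝ) * Q ^ 2 * n.factorial ≤
      512 * h ^ 5 / n * n.factorial * n.descFactorial 4 := by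
    have h2 : ((blockQuadruples β).card : ℝ) ≤ n * (2 * h) ^ 3 := by
      exact_mod_cast card_blockQuadruples_le hB
    calc ((blockQuadruples β).card : ℝ) * Q ^ 2 * n.factorial
        ≤ (n * (2 * h) ^ 3) * (n * (2 * h)) ^ 2 * n.factorial := by gcongr
      _ = 32 * h ^ 5 / n * n.factorial * (n : ℝ) ^ 4 := by field_simp; ring
      _ ≤ 32 * h ^ 5 / n * n.factorial * (16 * (n.descFactorial 4 : ℝ)) := by
          gcongr
          exact pow_four_le_mul_descFactorial_four hn
      _ = _ := by ring
  have hDa : ∑ π : Equiv.Perm (Fin n),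
      (({p ∈ disjointGoodPairs β π | β p.1.1 = β p.2.1}).card : ℝ) ≤
      512 * h ^ 5 / n * n.factorial := by
    refine le_of_mul_le_mul_right (le_trans ?_ hquad) hd4
    rw [hQ]
    exact_mod_cast sum_card_disjoint_same_position_block_le β
  have hDb : ∑ π : Equiv.Perm (Fin n),
      (({p ∈ disjointGoodPairs β π | β (π p.1.1) = β (π p.2.1)}).card : ℝ) ≤
      512 * h ^ 5 / n * n.factorial := by
    refine le_of_mul_le_mul_right (le_trans ?_ hquad) hd4
    rw [hQ]
    exact_mod_cast sum_card_disjoint_same_value_block_le β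
  have hX2 : ∑ π : Equiv.Perm (Fin n), ((goodPairs β π).card : ℝ) ^ 2 ≤
      (μ ^ 2 + (μ + 512 * h ^ 4 / n + 16 / n * μ ^ 2)) * n.factorial := by
    calc ∑ π : Equiv.Perm (Fin n), ((goodPairs β π).card : ℝ) ^ 2
        ≤ ∑ π : Equiv.Perm (Fin n), (((goodPairs β π).card : ℝ) +
            4 * ((goodTriples β π).card : ℝ) + ((disjointGoodPairs β π).card : ℝ)) :=
          Finset.sum_le_sum fun π _ => by exact_mod_cast card_goodPairs_sq_le β π
      _ ≤ μ * n.factorial + 4 * (128 * h ^ 4 / n * n.factorial) +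
            (1 + 16 / n) * μ ^ 2 * n.factorial := by
          rw [Finset.sum_add_distrib, Finset.sum_add_distrib, ← Finset.mul_sum, hX]
          gcongr
      _ = _ := by ring
  have hC : ∑ π : Equiv.Perm (Fin n), ((conflicts β π).card : ℝ) ≤
      1536 * h ^ 5 / n * n.factorial := by
    calc ∑ π : Equiv.Perm (Fin n), ((conflicts β π).card : ℝ)
        ≤ ∑ π : Equiv.Perm (Fin n), (4 * ((goodTriples β π).card : ℝ) +
            (({p ∈ disjointGoodPairs β π | β p.1.1 = β p.2.1}).card : ℝ) +
            (({p ∈ disjointGoodPairs β π | β (π p.1.1) = β (π p.2.1)}).card : ℝ)) :=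
          Finset.sum_le_sum fun π _ => by exact_mod_cast card_conflicts_le β π
      _ ≤ 4 * (128 * h ^ 4 / n * n.factorial) + 512 * h ^ 5 / n * n.factorial +
            512 * h ^ 5 / n * n.factorial := by
          rw [Finset.sum_add_distrib, Finset.sum_add_distrib, ← Finset.mul_sum]
          gcongr
      _ ≤ 4 * (128 * h ^ 5 / n * n.factorial) + 512 * h ^ 5 / n * n.factorial +
            512 * h ^ 5 / n * n.factorial := by
          have : (h : ℝ) ^ 4 ≤ (h : ℝ) ^ 5 := pow_le_pow_right₀ hh1 (by norm_num)
          gcongr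
      _ = _ := by ring
  have hcardΩ : Fintype.card (Equiv.Perm (Fin n)) = n.factorial := by
    rw [Fintype.card_perm, Fintype.card_fin]
  have hmain := card_sub_lt_quarter_mean_le (Ω := Equiv.Perm (Fin n))
    (fun π => ((goodPairs β π).card : ℝ)) (fun π => ((conflicts β π).card : ℝ))
    (fun _ => Nat.cast_nonneg _) hμ0 (by rw [hcardΩ]; exact hX) (by rw [hcardΩ]; exact hX2)
    (by rw [hcardΩ]; exact hC)
  rw [hcardΩ] at hmain
  rw [Nat.card_eq_fintype_card, Fintype.card_subtype]
  refine (Nat.cast_le.2 (Finset.card_le_card fun π => ?_)).trans (hmain.trans ?_)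
  · simp only [Finset.mem_filter, Finset.mem_univ, true_and]
    intro hπ
    have : ((goodPairs β π).card : ℝ) ≤ twinLen π + (conflicts β π).card := by
      exact_mod_cast card_goodPairs_le_twinLen_add π (blockIndex_monotone (2 * h))
    linarith
  · refine mul_le_mul_of_nonneg_right ?_ hF.le
    have e1 : 1 / μ ≤ 16 / (h : ℝ) ^ 2 := by
      rw [div_le_div_iff₀ hμ0 (by positivity)]
      linarith
    have e0 : 0 ≤ 1 / μ := by positivity
    calc 4 * (μ + 512 * (h : ℝ) ^ 4 / n + 16 / n * μ ^ 2) / μ ^ 2 +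
          4 * (1536 * (h : ℝ) ^ 5 / n) / μ
        = 4 * (1 / μ) + 2048 * (h : ℝ) ^ 4 / n * (1 / μ) ^ 2 + 64 / n +
            6144 * (h : ℝ) ^ 5 / n * (1 / μ) := by field_simp; ring
      _ ≤ 4 * (16 / (h : ℝ) ^ 2) + 2048 * (h : ℝ) ^ 4 / n * (16 / (h : ℝ) ^ 2) ^ 2 + 64 / n +
            6144 * (h : ℝ) ^ 5 / n * (16 / (h : ℝ) ^ 2) := by gcongr
      _ = 64 / (h : ℝ) ^ 2 + 524352 / n + 98304 * ((h : ℝ) ^ 3 / n) := by field_simp; ring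
      _ ≤ _ := by gcongr <;> norm_num

/-- The half-length of the blocks used for permutations of `[n]`, before rounding. -/
noncomputable def blockScale (n : ℕ) : ℝ :=
  (n : ℝ) ^ ((1 : ℝ) / 3) / Real.log n ^ ((1 : ℝ) / 6)

theorem blockScale_sq (n : ℕ) :
    blockScale n ^ 2 = (n : ℝ) ^ ((2 : ℝ) / 3) / Real.log n ^ ((1 : ℝ) / 3) := by
  have hlog : 0 ≤ Real.log n := Real.log_natCast_nonneg n
  rw [blockScale, div_pow, ← Real.rpow_mul_natCast n.cast_nonneg, ← Real.rpow_mul_natCast hlog]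
  norm_num

theorem blockScale_cube_div {n : ℕ} (hn : 3 ≤ n) :
    blockScale n ^ 3 / n = (Real.log n ^ ((1 : ℝ) / 2))⁻¹ := by
  have hlog : 0 ≤ Real.log n := Real.log_natCast_nonneg n
  have hn0 : (n : ℝ) ≠ 0 := by exact_mod_cast (by omega : n ≠ 0)
  rw [blockScale, div_pow, ← Real.rpow_mul_natCast n.cast_nonneg, ← Real.rpow_mul_natCast hlog]
  norm_num
  field_simp

theorem tendsto_blockScale : Filter.Tendsto blockScale Filter.atTop Filter.atTop := by
  have h : Filter.Tendsto (fun n : ℕ => (n : ℝ) ^ ((1 : ℝ) / 6)) Filter.atTop Filter.atTop :=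
    (tendsto_rpow_atTop (by norm_num)).comp tendsto_natCast_atTop_atTop
  refine Filter.tendsto_atTop_mono' _ ?_ h
  filter_upwards [Filter.eventually_ge_atTop 3] with n hn
  have hn1 : (1 : ℝ) < n := by exact_mod_cast (by omega : 1 < n)
  have hlog : 0 < Real.log n := Real.log_pos hn1
  rw [blockScale, le_div_iff₀ (by positivity)]
  calc (n : ℝ) ^ ((1 : ℝ) / 6) * Real.log n ^ ((1 : ℝ) / 6)
      ≤ (n : ℝ) ^ ((1 : ℝ) / 6) * (n : ℝ) ^ ((1 : ℝ) / 6) := by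
        gcongr
        exact Real.log_le_self n.cast_nonneg
    _ = (n : ℝ) ^ ((1 : ℝ) / 3) := by
        rw [← Real.rpow_add (by linarith)]
        norm_num

theorem tendsto_blockScale_cube_div :
    Filter.Tendsto (fun n : ℕ => blockScale n ^ 3 / n) Filter.atTop (nhds 0) := by
  have h : Filter.Tendsto (fun n : ℕ => (Real.log n ^ ((1 : ℝ) / 2))⁻¹) Filter.atTop (nhds 0) :=
    ((tendsto_rpow_atTop (by norm_num)).comp
      (Real.tendsto_log_atTop.comp tendsto_natCast_atTop_atTop)).inv_tendsto_atTop
  refine h.congr' ?_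
  filter_upwards [Filter.eventually_ge_atTop 3] with n hn
  exact (blockScale_cube_div hn).symm

/-- There is a constant $c > 0$ such that the proportion of $n$-permutations $π$ with
$t(π) ≥ c·n^{2/3}/(\log n)^{1/3}$ tends to $1$: a.a.s. a random permutation contains
twins of length $Ω(n^{2/3}/(\log n)^{1/3})$. -/
theorem random_twins_lower_log :
    ∃ c : ℝ, 0 < c ∧
      Filter.Tendsto (fun n : ℕ =>
          (Nat.card {π : Equiv.Perm (Fin n) //
              c * (n : ℝ) ^ ((2 : ℝ) / 3) / (Real.log n) ^ ((1 : ℝ) / 3)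
                ≤ (twinLen π : ℝ)} : ℝ) / (Nat.factorial n : ℝ))
        Filter.atTop (nhds 1) := by
  classical
  refine ⟨1 / 256, by norm_num, ?_⟩
  set y := blockScale
  have hbound : Filter.Tendsto (fun n : ℕ =>
      1 - (256 / y n ^ 2 + 600000 / (n : ℝ) + 100000 * (y n ^ 3 / n)))
      Filter.atTop (nhds 1) := by
    have h1 : Filter.Tendsto (fun n : ℕ => 256 / y n ^ 2) Filter.atTop (nhds 0) :=
      ((Filter.tendsto_pow_atTop two_ne_zero).comp tendsto_blockScale).const_div_atTop 256
    have h2 : Filter.Tendsto (fun n : ℕ => 600000 / (n : ℝ)) Filter.atTop (nhds 0) :=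
      tendsto_const_div_atTop_nhds_zero_nat 600000
    simpa using ((h1.add h2).add (tendsto_blockScale_cube_div.const_mul 100000)).const_sub 1
  refine tendsto_of_tendsto_of_tendsto_of_le_of_le' hbound tendsto_const_nhds ?_ ?_
  · filter_upwards [Filter.eventually_ge_atTop 6, tendsto_blockScale.eventually_ge_atTop 2,
      tendsto_blockScale_cube_div.eventually (gt_mem_nhds (by norm_num : (0 : ℝ) < 1 / 4))]
      with n hn hy hy3
    have hn0 : (0 : ℝ) < n := by exact_mod_cast (by omega : 0 < n)
    have hF : (0 : ℝ) < n.factorial := by exact_mod_cast n.factorial_pos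
    have hy' : 2 ≤ y n := hy
    set h := ⌊y n⌋₊ with hh
    have hle : (h : ℝ) ≤ y n := Nat.floor_le (by linarith)
    have hge : y n / 2 ≤ h := by
      have := Nat.lt_floor_add_one (y n)
      linarith
    have hh1 : 1 ≤ h := Nat.le_floor (by push_cast; linarith)
    have hh1' : (1 : ℝ) ≤ h := by exact_mod_cast hh1
    have hhn : 4 * h ≤ n := by
      have h1 : y n ^ 3 < 1 / 4 * n := (div_lt_iff₀ hn0).1 hy3
      have h2 : (h : ℝ) ^ 3 ≤ y n ^ 3 := by gcongr
      have h3 : (h : ℝ) ≤ (h : ℝ) ^ 3 := le_self_pow₀ hh1' (by norm_num)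
      have h4 : (4 * h : ℝ) ≤ n := by linarith
      exact_mod_cast h4
    have hbad := card_twinLen_lt_le hn hh1 hhn
    have hthr : 1 / 256 * (n : ℝ) ^ ((2 : ℝ) / 3) / Real.log n ^ ((1 : ℝ) / 3) ≤
        (h : ℝ) ^ 2 / 64 := by
      rw [mul_div_assoc, ← blockScale_sq n]
      have : (y n / 2) ^ 2 ≤ (h : ℝ) ^ 2 := by gcongr
      change 1 / 256 * y n ^ 2 ≤ _
      linarith
    have hcount : (n.factorial : ℝ) ≤
        (Nat.card {π : Equiv.Perm (Fin n) //
          1 / 256 * (n : ℝ) ^ ((2 : ℝ) / 3) / (Real.log n) ^ ((1 : ℝ) / 3) ≤ (twinLen π : ℝ)} : ℝ) +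
        (Nat.card {π : Equiv.Perm (Fin n) // (twinLen π : ℝ) < (h : ℝ) ^ 2 / 64} : ℝ) := by
      have hperm : n.factorial = (Finset.univ : Finset (Equiv.Perm (Fin n))).card := by
        rw [Finset.card_univ, Fintype.card_perm, Fintype.card_fin]
      simp only [Nat.card_eq_fintype_card, Fintype.card_subtype]
      rw [hperm, ← Nat.cast_add, Nat.cast_le]
      refine (Finset.card_le_card fun π _ => ?_).trans (Finset.card_union_le _ _)
      simp only [Finset.mem_union, Finset.mem_filter, Finset.mem_univ, true_and]
      exact (le_or_gt _ _).imp_left hthr.trans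
    have hmono : 64 / (h : ℝ) ^ 2 + 600000 / n + 100000 * ((h : ℝ) ^ 3 / n) ≤
        256 / y n ^ 2 + 600000 / (n : ℝ) + 100000 * (y n ^ 3 / n) := by
      have : 64 / (h : ℝ) ^ 2 ≤ 256 / y n ^ 2 := by
        calc 64 / (h : ℝ) ^ 2 ≤ 64 / (y n / 2) ^ 2 := by gcongr
          _ = 256 / y n ^ 2 := by field_simp; norm_num
      gcongr ?_ + _ + 100000 * (?_ ^ 3 / _)
    rw [le_div_iff₀ hF]
    have := mul_le_mul_of_nonneg_right hmono hF.le
    linarith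
  · refine Filter.Eventually.of_forall fun n => ?_
    have hF : (0 : ℝ) < n.factorial := by exact_mod_cast n.factorial_pos
    rw [div_le_one hF, Nat.cast_le]
    refine (Finite.card_subtype_le _).trans ?_
    rw [Nat.card_eq_fintype_card, Fintype.card_perm, Fintype.card_fin]
end

section
/- Let a = a(n) be a sequence of positive integers with a(n) → ∞ and a(n)²/n → 0, and for each n fix sets A, B ⊆ [n] with |A| = |B| = a(n). For a uniformly random permutation Π of [n], let X be the number of positions i ∈ A with Π(i) ∈ B. Then P(X ≥ 2) is asymptotically equal to a⁴/(2n²), i.e., P(X ≥ 2)·2n²/a⁴ → 1 as n → ∞. -/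
open Finset Filter Asymptotics Topology

/-- The embeddings of `Fin k` into a type that land in a given finset are counted by a falling
factorial. -/
theorem card_embeddings_into_finset {α : Type*} [Fintype α] [DecidableEq α] (s : Finset α)
    (k : ℕ) :
    #{f : Fin k ↪ α | ∀ i, f i ∈ s} = (#s).descFactorial k := by
  have hcard := Fintype.card_congr (Equiv.codRestrict (Fin k) (s : Set α))
  simpa [Fintype.card_subtype, Fintype.card_embedding_eq] using hcard

/-- Every injective placement of `k` values at `k` given positions is realized by the same number
of permutations. -/
theorem card_perm_smul_eq_mul_descFactorial {α : Type*} [Fintype α] [DecidableEq α] {k : ℕ}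
    (f g : Fin k ↪ α) :
    #{π : Equiv.Perm α | π • f = g} * (Fintype.card α).descFactorial k
      = (Fintype.card α).factorial := by
  have hconst (h : Fin k ↪ α) :
      #{π : Equiv.Perm α | π • f = h} = #{π : Equiv.Perm α | π • f = g} := by
    obtain ⟨σ, rfl⟩ := Equiv.Perm.exists_smul_eq_embedding h g
    refine card_bij (fun π _ => σ * π) ?_ ?_ ?_
    · intro π hπ
      simp_all [mul_smul]
    · intro π _ τ _ hπτ
      exact mul_left_cancel hπτ
    · intro π hπ
      refine ⟨σ⁻¹ * π, ?_, by simp⟩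
      simp_all [mul_smul]
  have hsum := card_eq_sum_card_fiberwise (s := (univ : Finset (Equiv.Perm α)))
    (t := (univ : Finset (Fin k ↪ α))) (f := fun π => π • f) (by simp [Set.MapsTo])
  rw [sum_congr rfl fun h _ => hconst h] at hsum
  simpa [Fintype.card_perm, Fintype.card_embedding_eq, mul_comm] using hsum.symm

/-- The factorial moments of the number of positions in `A` that a permutation maps into `B`. -/
theorem sum_descFactorial_hits_mul_descFactorial {α : Type*} [Fintype α] [DecidableEq α]
    (A B : Finset α) (k : ℕ) :
    (∑ π : Equiv.Perm α, (#{i ∈ A | π i ∈ B}).descFactorial k)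
        * (Fintype.card α).descFactorial k
      = (#A).descFactorial k * (#B).descFactorial k * (Fintype.card α).factorial := by
  have hpairs (π : Equiv.Perm α) : (#{i ∈ A | π i ∈ B}).descFactorial k
      = ∑ f : Fin k ↪ α with ∀ i, f i ∈ A, ∑ g : Fin k ↪ α with ∀ i, g i ∈ B,
          if π • f = g then 1 else 0 := by
    rw [← card_embeddings_into_finset]
    simp only [sum_ite_eq, mem_filter, mem_univ, true_and, sum_boole, filter_filter]
    simp only [forall_and, Function.Embedding.smul_apply, Equiv.Perm.smul_def, Nat.cast_id]
    congr!
  simp_rw [hpairs]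
  rw [sum_comm, sum_congr rfl fun f _ => sum_comm]
  simp_rw [sum_boole, Nat.cast_id, sum_mul, card_perm_smul_eq_mul_descFactorial]
  simp [card_embeddings_into_finset, mul_assoc]

theorem two_mul_ite_le_descFactorial_two (m : ℕ) :
    2 * (if 2 ≤ m then 1 else 0) ≤ m.descFactorial 2 := by
  match m with
  | 0 | 1 => simp
  | m + 2 =>
    simp [Nat.descFactorial]
    nlinarith

theorem descFactorial_two_le_add_descFactorial_three (m : ℕ) :
    m.descFactorial 2 ≤ 2 * (if 2 ≤ m then 1 else 0) + m.descFactorial 3 := by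
  match m with
  | 0 | 1 | 2 => simp [Nat.descFactorial]
  | m + 3 =>
    simp [Nat.descFactorial]
    nlinarith [Nat.zero_le (m * ((m + 2) * (m + 3)))]

theorem tendsto_descFactorial_div_pow (k : ℕ) :
    Tendsto (fun n : ℕ => (n.descFactorial k : ℝ) / (n : ℝ) ^ k) atTop (𝓝 1) := by
  refine (isEquivalent_iff_tendsto_one ?_).mp (isEquivalent_descFactorial k)
  filter_upwards [eventually_ne_atTop 0] with n hn
  positivity

/-- Let $a(n) → ∞$ with $a(n)²/n → 0$, and fix sets $A, B ⊆ [n]$ of size $a(n)$.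
For a random permutation $Π$, if $X$ is the number of $i ∈ A$ with $Π(i) ∈ B$, then
$P(X ≥ 2) ∼ a⁴/(2n²)$, i.e. $P(X ≥ 2)·2n²/a⁴ → 1$. -/
theorem prob_two_hits_asymptotics (a : ℕ → ℕ)
    (ha : Filter.Tendsto a Filter.atTop Filter.atTop)
    (ha2 : Filter.Tendsto (fun n : ℕ => ((a n : ℝ)) ^ 2 / (n : ℝ))
      Filter.atTop (nhds 0))
    (A B : (n : ℕ) → Finset (Fin n))
    (hA : ∀ n, (A n).card = a n) (hB : ∀ n, (B n).card = a n) :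
    Filter.Tendsto (fun n : ℕ =>
        ((Nat.card {π : Equiv.Perm (Fin n) //
            2 ≤ ((A n).filter (fun i => π i ∈ B n)).card} : ℝ)
          / (Nat.factorial n : ℝ)) * (2 * (n : ℝ) ^ 2) / ((a n : ℝ) ^ 4))
      Filter.atTop (nhds 1) := by
  have hratio (k : ℕ) : Tendsto (fun n : ℕ => ((a n).descFactorial k / (a n : ℝ) ^ k) ^ 2
      / (n.descFactorial k / (n : ℝ) ^ k)) atTop (𝓝 1) := by
    simpa only [one_pow, div_one, Function.comp_def, Pi.div_def] using
      (((tendsto_descFactorial_div_pow k).comp ha).pow 2).div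
        (tendsto_descFactorial_div_pow k) one_ne_zero
  have hlower := (hratio 2).sub (ha2.mul (hratio 3))
  rw [zero_mul, sub_zero] at hlower
  have hmoment (n k : ℕ) (hk : k ≤ n) :
      ((∑ π : Equiv.Perm (Fin n), (#{i ∈ A n | π i ∈ B n}).descFactorial k : ℕ) : ℝ)
        = ((a n).descFactorial k : ℝ) ^ 2 * n.factorial / n.descFactorial k := by
    have hpos : (0 : ℝ) < n.descFactorial k := by
      exact_mod_cast Nat.descFactorial_pos.mpr hk
    rw [eq_div_iff hpos.ne', sq]
    have h := sum_descFactorial_hits_mul_descFactorial (A n) (B n) k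
    rw [hA, hB, Fintype.card_fin] at h
    exact_mod_cast h
  have hcount (n : ℕ) :
      ∑ π : Equiv.Perm (Fin n), 2 * (if 2 ≤ #{i ∈ A n | π i ∈ B n} then 1 else 0)
        = 2 * Nat.card {π : Equiv.Perm (Fin n) // 2 ≤ #{i ∈ A n | π i ∈ B n}} := by
    rw [← mul_sum, sum_boole, Nat.card_eq_fintype_card, Fintype.card_subtype, Nat.cast_id]
  refine tendsto_of_tendsto_of_tendsto_of_le_of_le' hlower (hratio 2) ?_ ?_
  · filter_upwards [eventually_ge_atTop 3, ha.eventually_gt_atTop 0] with n hn han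
    have hle := sum_le_sum fun (π : Equiv.Perm (Fin n)) (_ : π ∈ univ) =>
      descFactorial_two_le_add_descFactorial_three #{i ∈ A n | π i ∈ B n}
    rw [sum_add_distrib, hcount] at hle
    have hle' := (Nat.cast_le (α := ℝ)).mpr hle
    rw [Nat.cast_add, hmoment n 2 (by lia), hmoment n 3 hn] at hle'
    push_cast at hle'
    have hd2 : (0 : ℝ) < n.descFactorial 2 := by
      exact_mod_cast Nat.descFactorial_pos.mpr (by lia)
    have hd3 : (0 : ℝ) < n.descFactorial 3 := by
      exact_mod_cast Nat.descFactorial_pos.mpr hn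
    have hfac : (0 : ℝ) < n.factorial := by exact_mod_cast n.factorial_pos
    have hn0 : (0 : ℝ) < n := by exact_mod_cast (by lia : 0 < n)
    have ha0 : (0 : ℝ) < a n := by exact_mod_cast han
    have hscaled := mul_le_mul_of_nonneg_right (sub_le_iff_le_add.mpr hle')
      (by positivity : (0 : ℝ) ≤ (n : ℝ) ^ 2 / (n.factorial * (a n : ℝ) ^ 4))
    convert hscaled using 1 <;> field_simp
  · filter_upwards [eventually_ge_atTop 3, ha.eventually_gt_atTop 0] with n hn han
    have hle := sum_le_sum fun (π : Equiv.Perm (Fin n)) (_ : π ∈ univ) =>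
      two_mul_ite_le_descFactorial_two #{i ∈ A n | π i ∈ B n}
    rw [hcount] at hle
    have hle' := (Nat.cast_le (α := ℝ)).mpr hle
    rw [hmoment n 2 (by lia)] at hle'
    push_cast at hle'
    have hd2 : (0 : ℝ) < n.descFactorial 2 := by
      exact_mod_cast Nat.descFactorial_pos.mpr (by lia)
    have hfac : (0 : ℝ) < n.factorial := by exact_mod_cast n.factorial_pos
    have hn0 : (0 : ℝ) < n := by exact_mod_cast (by lia : 0 < n)
    have ha0 : (0 : ℝ) < a n := by exact_mod_cast han
    have hscaled := mul_le_mul_of_nonneg_right hle'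
      (by positivity : (0 : ℝ) ≤ (n : ℝ) ^ 2 / (n.factorial * (a n : ℝ) ^ 4))
    convert hscaled using 1 <;> field_simp
end

section
/- Let k ≥ 1, r ≥ 2, and let A_i, B_i ⊆ [n] for i = 1,…,r be k-element blocks (sets of k consecutive integers) with A_i ∩ B_i = ∅ for each i, and with A_1 disjoint from the union of all A_i ∪ B_i for i = 2,…,r. For each i let E_i be the set of permutations π of [n] for which (A_i, B_i) forms a pair of block twins. Then |E_1 ∩ E_2 ∩ … ∩ E_r| = |E_2 ∩ … ∩ E_r|/k!; equivalently, for a uniformly random permutation, P(E_1 ∩ … ∩ E_r) = P(E_1)·P(E_2 ∩ … ∩ E_r). -/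
/-- Two injective tuples in a linear order can be made order-isomorphic by permuting the indices
of the first one, in exactly one way. -/
theorem existsUnique_perm_lt_iff_lt {k : ℕ} {α : Type*} [LinearOrder α] {u v : Fin k → α}
    (hu : Function.Injective u) (hv : Function.Injective v) :
    ∃! σ : Equiv.Perm (Fin k), ∀ a b, u (σ a) < u (σ b) ↔ v a < v b := by
  have hsu : StrictMono (u ∘ Tuple.sort u) :=
    (Tuple.monotone_sort u).strictMono_of_injective (hu.comp (Tuple.sort u).injective)
  have hsv : StrictMono (v ∘ Tuple.sort v) :=
    (Tuple.monotone_sort v).strictMono_of_injective (hv.comp (Tuple.sort v).injective)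
  refine ⟨Tuple.sort u * (Tuple.sort v)⁻¹, fun a b => ?_, fun τ hτ => ?_⟩
  · have h₁ := hsu.lt_iff_lt (a := (Tuple.sort v)⁻¹ a) (b := (Tuple.sort v)⁻¹ b)
    have h₂ := hsv.lt_iff_lt (a := (Tuple.sort v)⁻¹ a) (b := (Tuple.sort v)⁻¹ b)
    simp only [Function.comp_apply, Equiv.Perm.coe_inv, Equiv.apply_symm_apply] at h₁ h₂
    exact h₁.trans h₂.symm
  · have hmono : StrictMono (u ∘ (τ * Tuple.sort v : Equiv.Perm (Fin k))) :=
      fun a b hab => (hτ _ _).2 (hsv hab)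
    have heq := Tuple.unique_monotone hmono.monotone hsu.monotone
    rw [eq_mul_inv_iff_mul_eq]
    exact Equiv.ext fun a => hu (congrFun heq a)

theorem IsBlockFun.strictMono {n k : ℕ} {f : Fin k → Fin n} (hf : IsBlockFun f) :
    StrictMono f := by
  obtain ⟨s, hs⟩ := hf
  intro a b hab
  rw [Fin.lt_def, hs, hs]
  exact Nat.add_lt_add_left hab s


/-- Fact about block twins: if $A_1$ (the first left block) is disjoint from all the other
blocks $A_i ∪ B_i$, $i ≥ 2$, then $|E_1 ∩ ⋯ ∩ E_r| = |E_2 ∩ ⋯ ∩ E_r|/k!$, where $E_i$ is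
the set of permutations for which $(A_i, B_i)$ forms a pair of block twins; equivalently
$P(E_1 ∩ ⋯ ∩ E_r) = P(E_1)·P(E_2 ∩ ⋯ ∩ E_r)$. Here $A_i$ and $B_i$ are the ranges of the
block enumerations $f_i$ and $g_i$. -/
theorem block_twins_independence (n k r : ℕ) (hk : 1 ≤ k) (hr : 2 ≤ r)
    (f g : Fin r → Fin k → Fin n)
    (hblock : ∀ i, IsBlockFun (f i) ∧ IsBlockFun (g i))
    (hdisj : ∀ i, ∀ a b : Fin k, f i a ≠ g i b)
    (hA1 : ∀ i : Fin r, (i : ℕ) ≠ 0 → ∀ a b : Fin k,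
      f ⟨0, by omega⟩ a ≠ f i b ∧ f ⟨0, by omega⟩ a ≠ g i b) :
    Nat.card {π : Equiv.Perm (Fin n) // ∀ i, IsTwinPair π (f i) (g i)}
        * Nat.factorial k
      = Nat.card {π : Equiv.Perm (Fin n) //
          ∀ i : Fin r, (i : ℕ) ≠ 0 → IsTwinPair π (f i) (g i)} := by
  set z : Fin r := ⟨0, by omega⟩ with hz
  have hz0 : ∀ i : Fin r, (i : ℕ) = 0 → i = z := fun i hi => Fin.ext hi
  have hf : ∀ i, StrictMono (f i) := fun i => (hblock i).1.strictMono
  have hg : ∀ i, StrictMono (g i) := fun i => (hblock i).2.strictMono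
  have htwin (π : Equiv.Perm (Fin n)) (i : Fin r) : IsTwinPair π (f i) (g i) ↔
      ∀ a b : Fin k, π (f i a) < π (f i b) ↔ π (g i a) < π (g i b) :=
    ⟨fun h => h.2.2.2, fun h => ⟨hf i, hg i, hdisj i, h⟩⟩
  simp only [htwin]
  let F : Fin k ↪ Fin n := ⟨f z, (hf z).injective⟩
  let e : Equiv.Perm (Fin k) →* Equiv.Perm (Fin n) := Equiv.Perm.viaEmbeddingHom F
  have he (σ : Equiv.Perm (Fin k)) (a : Fin k) : e σ (f z a) = f z (σ a) :=
    Equiv.Perm.viaEmbedding_apply σ F a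
  have he' (σ : Equiv.Perm (Fin k)) (x : Fin n) (hx : ∀ a, f z a ≠ x) : e σ x = x :=
    Equiv.Perm.viaEmbedding_apply_of_notMem σ F x (by rintro ⟨a, ha⟩; exact hx a ha)
  have hef (σ : Equiv.Perm (Fin k)) (i : Fin r) (hi : (i : ℕ) ≠ 0) (a : Fin k) :
      e σ (f i a) = f i a := he' σ _ fun b => (hA1 i hi b a).1
  have heg (σ : Equiv.Perm (Fin k)) (i : Fin r) (a : Fin k) : e σ (g i a) = g i a := by
    refine he' σ _ fun b => ?_
    by_cases hi : (i : ℕ) = 0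
    · rw [hz0 i hi]
      exact hdisj z b a
    · exact (hA1 i hi b a).2
  have hunique (ρ : Equiv.Perm (Fin n)) := existsUnique_perm_lt_iff_lt
    (ρ.injective.comp (hf z).injective) (ρ.injective.comp (hg z).injective)
  have hcard : Nat.factorial k = Nat.card (Equiv.Perm (Fin k)) := by
    rw [Nat.card_perm, Nat.card_fin]
  rw [hcard, ← Nat.card_prod]
  refine Nat.card_eq_of_bijective (fun p => ⟨p.1.1 * e p.2, fun i hi a b => ?_⟩) ⟨?_, ?_⟩
  · simp only [Equiv.Perm.mul_apply, hef _ i hi, heg]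
    exact p.1.2 i a b
  · rintro ⟨⟨π, hπ⟩, σ⟩ ⟨⟨π', hπ'⟩, σ'⟩ h
    have hmul : π * e σ = π' * e σ' := congrArg Subtype.val h
    have key (π₀ : Equiv.Perm (Fin n)) (σ₀ : Equiv.Perm (Fin k))
        (h₀ : ∀ a b, π₀ (f z a) < π₀ (f z b) ↔ π₀ (g z a) < π₀ (g z b)) (a b : Fin k) :
        (⇑(π₀ * e σ₀) ∘ f z) (σ₀⁻¹ a) < (⇑(π₀ * e σ₀) ∘ f z) (σ₀⁻¹ b) ↔
          (⇑(π₀ * e σ₀) ∘ g z) a < (⇑(π₀ * e σ₀) ∘ g z) b := by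
      simpa only [Function.comp_apply, Equiv.Perm.mul_apply, he, heg,
        Equiv.Perm.coe_inv, Equiv.apply_symm_apply] using h₀ a b
    have hσ : σ = σ' := inv_injective <|
      (hunique (π * e σ)).unique (key π σ (hπ z)) (hmul ▸ key π' σ' (hπ' z))
    subst hσ
    have hππ : π = π' := mul_right_cancel hmul
    subst hππ
    rfl
  · rintro ⟨ρ, hρ⟩
    obtain ⟨τ, hτ⟩ := (hunique ρ).exists
    refine ⟨⟨⟨ρ * e τ, fun i a b => ?_⟩, τ⁻¹⟩, Subtype.ext ?_⟩
    · by_cases hi : (i : ℕ) = 0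
      · rw [hz0 i hi]
        simpa only [Function.comp_apply, Equiv.Perm.mul_apply, he, heg] using hτ a b
      · simpa only [Equiv.Perm.mul_apply, hef _ i hi, heg] using hρ i hi a b
    · simp
end

section
/- Let a divide n and partition [n] into consecutive blocks A_1, …, A_{n/a}, each of size a (A_ℓ = {(ℓ−1)a+1, …, ℓa}). Let π be a permutation of [n]. Suppose there exist indices i_1 < i_2 < … < i_m in {1,…,n/a} and pairwise distinct indices j_1, …, j_m in {1,…,n/a} such that for every ℓ ∈ {1,…,m} there are two distinct positions s_ℓ, t_ℓ ∈ A_{i_ℓ} with both π(s_ℓ) ∈ A_{j_ℓ} and π(t_ℓ) ∈ A_{j_ℓ}. Then π contains a pair of twins of length m, i.e., t(π) ≥ m. -/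
/-- $x$ lies in the $ℓ$-th consecutive block of size $a$ (blocks indexed from $0$). -/
def inBlock (a ℓ x : ℕ) : Prop := ℓ * a ≤ x ∧ x < (ℓ + 1) * a

theorem inBlock.lt_of_lt {a k l x y : ℕ} (hx : inBlock a k x) (hy : inBlock a l y)
    (hkl : k < l) : x < y :=
  hx.2.trans_le ((Nat.mul_le_mul_right a hkl).trans hy.1)

theorem inBlock.lt_iff {a k l x y : ℕ} (hx : inBlock a k x) (hy : inBlock a l y)
    (hkl : k ≠ l) : x < y ↔ k < l := by
  refine ⟨fun hxy => ?_, hx.lt_of_lt hy⟩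
  by_contra hlk
  exact hxy.asymm (hy.lt_of_lt hx (lt_of_le_of_ne (not_lt.mp hlk) hkl.symm))

/-- Partition $[n]$ into $n/a$ consecutive blocks of size $a$. If there are indices
$i_1 < ⋯ < i_m$ and pairwise distinct $j_1, …, j_m$ such that for each $ℓ$ two distinct
positions $s_ℓ ≠ t_ℓ$ of block $A_{i_ℓ}$ are mapped by $π$ into block $A_{j_ℓ}$,
then $π$ contains a pair of twins of length $m$. -/
theorem matching_gives_twins (n a m : ℕ) (ha : 1 ≤ a) (hdvd : a ∣ n)
    (π : Equiv.Perm (Fin n))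
    (i j : Fin m → ℕ) (hi : StrictMono i) (hj : Function.Injective j)
    (hirange : ∀ ℓ, i ℓ < n / a) (hjrange : ∀ ℓ, j ℓ < n / a)
    (s t : Fin m → Fin n) (hst : ∀ ℓ, s ℓ ≠ t ℓ)
    (hs  : ∀ ℓ, inBlock a (i ℓ) (s ℓ) ∧ inBlock a (i ℓ) (t ℓ))
    (hπ : ∀ ℓ, inBlock a (j ℓ) (π (s ℓ)) ∧ inBlock a (j ℓ) (π (t ℓ))) :
    HasTwins π m := by
  refine ⟨s, t, fun b c hbc => (hs b).1.lt_of_lt (hs c).1 (hi hbc),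
    fun b c hbc => (hs b).2.lt_of_lt (hs c).2 (hi hbc), fun b c => ?_, fun b c => ?_⟩
  · rcases lt_trichotomy b c with h | rfl | h
    · exact Fin.ne_of_lt ((hs b).1.lt_of_lt (hs c).2 (hi h))
    · exact hst b
    · exact Fin.ne_of_gt ((hs c).2.lt_of_lt (hs b).1 (hi h))
  · rcases eq_or_ne b c with rfl | h
    · simp
    · exact ((hπ b).1.lt_iff (hπ c).1 (hj.ne h)).trans
        ((hπ b).2.lt_iff (hπ c).2 (hj.ne h)).symm
end

section
/- For all positive integers k and n satisfying 4·e·k·n ≤ k! (equivalently n ≤ (k−1)!/(4e)), there exists a permutation π of [n] containing no pair of block twins of length k. -/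
/-- If a set `F` of permutations is stable under permuting the positions in the range of `g`, then
at most a `1 / k!` fraction of its elements have the same pattern along `f` and along `g`. -/
theorem card_filter_same_pattern_mul_factorial_le {n k : ℕ} (F : Finset (Equiv.Perm (Fin n)))
    (f : Fin k → Fin n) (g : Fin k ↪ Fin n) (hfg : ∀ a b, f a ≠ g b)
    (hF : ∀ π ∈ F, ∀ σ : Equiv.Perm (Fin k), π * σ.viaEmbedding g ∈ F) :
    (F.filter fun π => ∀ a b, π (f a) < π (f b) ↔ π (g a) < π (g b)).card * k.factorial
      ≤ F.card := by
  have hcard : k.factorial = (Finset.univ : Finset (Equiv.Perm (Fin k))).card := by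
    simp [Finset.card_univ, Fintype.card_perm]
  rw [hcard, ← Finset.card_product]
  refine Finset.card_le_card_of_injOn (fun p => p.1 * p.2.viaEmbedding g) ?_ ?_
  · rintro ⟨π, σ⟩ hp
    simp only [Finset.coe_product, Finset.coe_filter, Set.mem_prod, Set.mem_ofPred_eq] at hp
    exact hF π hp.1.1 σ
  · rintro ⟨π, σ⟩ hp ⟨π', σ'⟩ hp' heq
    simp only [Finset.coe_product, Finset.coe_filter, Set.mem_prod, Set.mem_ofPred_eq] at hp hp'
    have heq' : ∀ x, π (σ.viaEmbedding g x) = π' (σ'.viaEmbedding g x) :=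
      fun x => DFunLike.congr_fun heq x
    have hf : ∀ a, π (f a) = π' (f a) := by
      intro a
      have ha : f a ∉ Set.range g := by
        rintro ⟨b, hb⟩
        exact hfg a b hb.symm
      simpa [Equiv.Perm.viaEmbedding_apply_of_notMem _ _ _ ha] using heq' (f a)
    have hg : ∀ a, π (g (σ a)) = π' (g (σ' a)) := by
      intro a
      simpa [Equiv.Perm.viaEmbedding_apply] using heq' (g a)
    have hlt : ∀ a b, π (f (σ a)) < π (f (σ b)) ↔ π (f (σ' a)) < π (f (σ' b)) := by
      intro a b
      rw [hp.1.2, hg, hg, ← hp'.1.2, hf, hf]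
    have hinj : Function.Injective f := by
      intro a b hab
      by_contra hne
      have h₁ := hp.1.2 a b
      have h₂ := hp.1.2 b a
      rw [hab] at h₁ h₂
      simp only [lt_self_iff_false, false_iff, not_lt] at h₁ h₂
      exact hne (g.injective (π.injective (le_antisymm h₂ h₁)))
    have hσ : σ = σ' := by
      let r : Fin k → Fin k → Prop := fun a b => π (f a) < π (f b)
      have hr : IsWellOrder (Fin k) r :=
        (RelEmbedding.isWellOrder (⟨⟨fun a => π (f a), π.injective.comp hinj⟩, Iff.rfl⟩ :
          r ↪r ((· < ·) : Fin n → Fin n → Prop)))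
      let e : r ≃r r := ⟨σ⁻¹.trans σ', fun {a b} => by
        simpa [r] using (hlt (σ⁻¹ a) (σ⁻¹ b)).symm⟩
      ext a
      have := DFunLike.congr_fun (Subsingleton.elim (RelIso.refl r).toInitialSeg e.toInitialSeg) (σ a)
      simpa [e] using congrArg Fin.val this
    subst hσ
    simpa using heq

/-- The block of `k` consecutive positions starting at `s`. -/
def blockEmbedding {n k s : ℕ} (h : s + k ≤ n) : Fin k ↪ Fin n :=
  ⟨fun a => ⟨s + a, by omega⟩, fun a b hab => by
    simpa [Fin.ext_iff] using hab⟩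

@[simp]
theorem val_blockEmbedding {n k s : ℕ} (h : s + k ≤ n) (a : Fin k) :
    (blockEmbedding h a : ℕ) = s + a := rfl

open Classical in
/-- The permutations of `[n]` without block twins of length `k` in the first `m` positions. -/
noncomputable def permsWithoutBlockTwins (n k m : ℕ) : Finset (Equiv.Perm (Fin n)) :=
  Finset.univ.filter fun π => ∀ f g : Fin k → Fin n, IsTwinPair π f g → IsBlockFun f →
    IsBlockFun g → (∀ a, (f a : ℕ) < m) → (∀ a, (g a : ℕ) < m) → False

theorem mem_permsWithoutBlockTwins {n k m : ℕ} {π : Equiv.Perm (Fin n)} :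
    π ∈ permsWithoutBlockTwins n k m ↔ ∀ f g : Fin k → Fin n, IsTwinPair π f g →
      IsBlockFun f → IsBlockFun g → (∀ a, (f a : ℕ) < m) → (∀ a, (g a : ℕ) < m) → False := by
  simp [permsWithoutBlockTwins]

theorem permsWithoutBlockTwins_anti {n k m m' : ℕ} (h : m ≤ m') :
    permsWithoutBlockTwins n k m' ⊆ permsWithoutBlockTwins n k m := by
  intro π hπ
  rw [mem_permsWithoutBlockTwins] at hπ ⊢
  exact fun f g ht hf hg hfm hgm =>
    hπ f g ht hf hg (fun a => (hfm a).trans_le h) (fun a => (hgm a).trans_le h)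

theorem permsWithoutBlockTwins_eq_univ {n k m : ℕ} (h : m < k) :
    permsWithoutBlockTwins n k m = Finset.univ := by
  refine Finset.eq_univ_iff_forall.2 fun π => mem_permsWithoutBlockTwins.2 ?_
  rintro f g - ⟨s, hs⟩ - hfm -
  have h₁ := hs ⟨m, h⟩
  have h₂ := hfm ⟨m, h⟩
  simp only at h₁
  omega

theorem IsTwinPair.symm {n k : ℕ} {π : Equiv.Perm (Fin n)} {f g : Fin k → Fin n}
    (h : IsTwinPair π f g) : IsTwinPair π g f :=
  ⟨h.2.1, h.1, fun a b hab => h.2.2.1 b a hab.symm, fun a b => (h.2.2.2 a b).symm⟩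

/-- Permuting positions from `t` on does not create block twins before `t`. -/
theorem mul_mem_permsWithoutBlockTwins {n k t : ℕ} {π τ : Equiv.Perm (Fin n)}
    (hτ : ∀ x : Fin n, (x : ℕ) < t → τ x = x) (hπ : π ∈ permsWithoutBlockTwins n k t) :
    π * τ ∈ permsWithoutBlockTwins n k t := by
  rw [mem_permsWithoutBlockTwins] at hπ ⊢
  intro f g ht hf hg hfm hgm
  refine hπ f g ⟨ht.1, ht.2.1, ht.2.2.1, fun a b => ?_⟩ hf hg hfm hgm
  simpa [hτ _ (hfm _), hτ _ (hgm _)] using ht.2.2.2 a b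

/-- New block twins in the first `t + k` positions that are absent from the first `t + k - 1`
consist of the block starting at `t` and of an earlier block. -/
theorem exists_blockEmbedding_same_pattern {n k m t : ℕ} (hk : 1 ≤ k) (hm : m + 1 = t + k)
    (ht : t + k ≤ n) {π : Equiv.Perm (Fin n)} (hπ : π ∈ permsWithoutBlockTwins n k m)
    (hπ' : π ∉ permsWithoutBlockTwins n k (m + 1)) :
    ∃ s : ℕ, ∃ hs : s + k ≤ t, ∀ a b : Fin k,
      π (blockEmbedding (hs.trans (Nat.le_of_add_right_le ht)) a) <
          π (blockEmbedding (hs.trans (Nat.le_of_add_right_le ht)) b) ↔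
        π (blockEmbedding ht a) < π (blockEmbedding ht b) := by
  rw [mem_permsWithoutBlockTwins] at hπ hπ'
  push Not at hπ'
  obtain ⟨f, g, htw, ⟨s, hs⟩, ⟨u, hu⟩, hfm, hgm, -⟩ := hπ'
  wlog hsu : s ≤ u generalizing f g s u
  · exact this g f htw.symm u hu s hs hgm hfm (by omega)
  have hsu' : s + k ≤ u := by
    by_contra hlt
    refine htw.2.2.1 ⟨u - s, by omega⟩ ⟨0, by omega⟩ (Fin.ext ?_)
    rw [hs, hu]
    simp only
    omega
  have hut : u = t := by
    have h₁ := hgm ⟨k - 1, by omega⟩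
    rw [hu] at h₁
    simp only at h₁
    by_contra hne
    refine hπ f g htw ⟨s, hs⟩ ⟨u, hu⟩ (fun a => ?_) (fun a => ?_)
    · rw [hs]; omega
    · rw [hu]; omega
  subst hut
  refine ⟨s, hsu', fun a b => ?_⟩
  have hf : ∀ a, blockEmbedding (hsu'.trans (Nat.le_of_add_right_le ht)) a = f a :=
    fun a => Fin.ext (hs a).symm
  have hg : ∀ a, blockEmbedding ht a = g a := fun a => Fin.ext (hu a).symm
  simpa only [hf, hg] using htw.2.2.2 a b

theorem card_permsWithoutBlockTwins_le {n k m t : ℕ} (hk : 1 ≤ k) (hm : m + 1 = t + k)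
    (ht : t + k ≤ n) :
    (permsWithoutBlockTwins n k m).card * k.factorial ≤
      (permsWithoutBlockTwins n k (m + 1)).card * k.factorial +
        n * (permsWithoutBlockTwins n k t).card := by
  classical
  have htn : t ≤ n := Nat.le_of_add_right_le ht
  let B : ℕ → Finset (Equiv.Perm (Fin n)) := fun s =>
    if hs : s + k ≤ t then
      (permsWithoutBlockTwins n k t).filter fun π => ∀ a b : Fin k,
        π (blockEmbedding (hs.trans htn) a) < π (blockEmbedding (hs.trans htn) b) ↔
          π (blockEmbedding ht a) < π (blockEmbedding ht b)
    else ∅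
  have hB : ∀ s, (B s).card * k.factorial ≤ (permsWithoutBlockTwins n k t).card := by
    intro s
    by_cases hs : s + k ≤ t
    · simp only [B, dif_pos hs]
      convert card_filter_same_pattern_mul_factorial_le (permsWithoutBlockTwins n k t)
        (blockEmbedding (hs.trans htn)) (blockEmbedding ht) ?_ ?_
      · intro a b hab
        have := congrArg Fin.val hab
        simp only [val_blockEmbedding] at this
        omega
      · intro π hπ σ
        refine mul_mem_permsWithoutBlockTwins (fun x hx => ?_) hπ
        refine Equiv.Perm.viaEmbedding_apply_of_notMem _ _ _ ?_
        rintro ⟨a, rfl⟩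
        simp at hx
    · simp [B, dif_neg hs]
  have hsub : permsWithoutBlockTwins n k m ⊆
      permsWithoutBlockTwins n k (m + 1) ∪ (Finset.range n).biUnion B := by
    intro π hπ
    by_cases hπ' : π ∈ permsWithoutBlockTwins n k (m + 1)
    · exact Finset.mem_union_left _ hπ'
    · obtain ⟨s, hs, hpat⟩ := exists_blockEmbedding_same_pattern hk hm ht hπ hπ'
      refine Finset.mem_union_right _ (Finset.mem_biUnion.2 ⟨s, ?_, ?_⟩)
      · rw [Finset.mem_range]; omega
      · simp only [B, dif_pos hs]
        exact Finset.mem_filter.2 ⟨permsWithoutBlockTwins_anti (by omega) hπ, hpat⟩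
  calc (permsWithoutBlockTwins n k m).card * k.factorial
      ≤ ((permsWithoutBlockTwins n k (m + 1)).card + ∑ s ∈ Finset.range n, (B s).card) *
          k.factorial := by
        gcongr
        exact (Finset.card_le_card hsub).trans ((Finset.card_union_le _ _).trans
          (Nat.add_le_add_left Finset.card_biUnion_le _))
    _ = (permsWithoutBlockTwins n k (m + 1)).card * k.factorial +
          ∑ s ∈ Finset.range n, (B s).card * k.factorial := by
        rw [add_mul, Finset.sum_mul]
    _ ≤ _ := by
        gcongr
        exact (Finset.sum_le_sum fun s _ => hB s).trans (by simp)

theorem one_le_exp_one_mul_one_sub_inv_pow {k : ℕ} (hk : 2 ≤ k) :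
    1 ≤ Real.exp 1 * (1 - 1 / (k : ℝ)) ^ (k - 1) := by
  obtain ⟨j, rfl⟩ : ∃ j, k = j + 2 := ⟨k - 2, by omega⟩
  have hj : (0 : ℝ) < j + 1 := by positivity
  have hq : 1 - 1 / ((j + 2 : ℕ) : ℝ) = (1 + 1 / ((j : ℝ) + 1))⁻¹ := by
    push_cast
    field_simp
    ring
  have hexp : (1 + 1 / ((j : ℝ) + 1)) ^ (j + 1) ≤ Real.exp 1 := by
    calc (1 + 1 / ((j : ℝ) + 1)) ^ (j + 1) ≤ Real.exp (1 / ((j : ℝ) + 1)) ^ (j + 1) := by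
          gcongr
          rw [add_comm]
          exact Real.add_one_le_exp _
      _ = Real.exp 1 := by
          rw [← Real.exp_nat_mul]
          congr 1
          push_cast
          field_simp
  rw [hq, inv_pow, show j + 2 - 1 = j + 1 by omega, ← div_eq_mul_inv, one_le_div (by positivity)]
  exact hexp

/-- Positions are revealed one at a time: each new position destroys at most a `1 / k` fraction of
the permutations without block twins. -/
theorem one_sub_inv_mul_card_permsWithoutBlockTwins_le {k n : ℕ} (hk : 2 ≤ k)
    (h : Real.exp 1 * k * n ≤ (k.factorial : ℝ)) (m : ℕ) (hm : m + 1 ≤ n) :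
    (1 - 1 / (k : ℝ)) * (permsWithoutBlockTwins n k m).card ≤
      (permsWithoutBlockTwins n k (m + 1)).card := by
  have hk0 : (0 : ℝ) < k := by positivity
  have hq : 0 ≤ 1 - 1 / (k : ℝ) := by
    rw [sub_nonneg, div_le_one hk0]
    exact_mod_cast (by omega : 1 ≤ k)
  induction m using Nat.strong_induction_on with
  | _ m ih =>
    rcases lt_or_ge (m + 1) k with hlt | hge
    · rw [permsWithoutBlockTwins_eq_univ hlt, permsWithoutBlockTwins_eq_univ (by omega)]
      refine mul_le_of_le_one_left (by positivity) ?_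
      rw [sub_le_self_iff]
      positivity
    · obtain ⟨t, ht⟩ : ∃ t, m + 1 = t + k := ⟨m + 1 - k, by omega⟩
      have hpow : ∀ i, t + i ≤ m → (1 - 1 / (k : ℝ)) ^ i * (permsWithoutBlockTwins n k t).card ≤
          (permsWithoutBlockTwins n k (t + i)).card := by
        intro i
        induction i with
        | zero => simp
        | succ i ih' =>
          intro hi
          calc (1 - 1 / (k : ℝ)) ^ (i + 1) * (permsWithoutBlockTwins n k t).card
              = (1 - 1 / (k : ℝ)) *
                  ((1 - 1 / (k : ℝ)) ^ i * (permsWithoutBlockTwins n k t).card) := by ring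
            _ ≤ (1 - 1 / (k : ℝ)) * (permsWithoutBlockTwins n k (t + i)).card :=
                mul_le_mul_of_nonneg_left (ih' (by omega)) hq
            _ ≤ _ := ih (t + i) (by omega) (by omega)
      have hmt : t + (k - 1) = m := by omega
      have h₁ := hpow (k - 1) hmt.le
      rw [hmt] at h₁
      have h₂ : ((permsWithoutBlockTwins n k t).card : ℝ) ≤
          Real.exp 1 * (permsWithoutBlockTwins n k m).card := by
        calc ((permsWithoutBlockTwins n k t).card : ℝ)
            ≤ Real.exp 1 * (1 - 1 / (k : ℝ)) ^ (k - 1) * (permsWithoutBlockTwins n k t).card :=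
              le_mul_of_one_le_left (by positivity) (one_le_exp_one_mul_one_sub_inv_pow hk)
          _ ≤ _ := by
              rw [mul_assoc]
              gcongr
      have h₃ : ((permsWithoutBlockTwins n k m).card : ℝ) * k.factorial ≤
          (permsWithoutBlockTwins n k (m + 1)).card * k.factorial +
            n * (permsWithoutBlockTwins n k t).card := by
        exact_mod_cast card_permsWithoutBlockTwins_le (by omega) ht (by omega)
      have h₄ : (n : ℝ) * (permsWithoutBlockTwins n k t).card ≤
          k.factorial / k * (permsWithoutBlockTwins n k m).card := by
        calc (n : ℝ) * (permsWithoutBlockTwins n k t).card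
            ≤ n * (Real.exp 1 * (permsWithoutBlockTwins n k m).card) := by gcongr
          _ = Real.exp 1 * n * (permsWithoutBlockTwins n k m).card := by ring
          _ ≤ _ := by
              gcongr
              rw [le_div_iff₀ hk0]
              linarith
      have hfac : (0 : ℝ) < k.factorial := by positivity
      refine le_of_mul_le_mul_right ?_ hfac
      calc (1 - 1 / (k : ℝ)) * (permsWithoutBlockTwins n k m).card * k.factorial
          = (permsWithoutBlockTwins n k m).card * k.factorial -
              k.factorial / k * (permsWithoutBlockTwins n k m).card := by ring
        _ ≤ _ := by linarith

theorem card_permsWithoutBlockTwins_pos {k n : ℕ} (hk : 2 ≤ k)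
    (h : Real.exp 1 * k * n ≤ (k.factorial : ℝ)) (m : ℕ) (hm : m ≤ n) :
    0 < (permsWithoutBlockTwins n k m).card := by
  induction m with
  | zero =>
    rw [permsWithoutBlockTwins_eq_univ (by omega)]
    exact Finset.card_pos.2 Finset.univ_nonempty
  | succ m ih =>
    have hq : 0 < 1 - 1 / (k : ℝ) := by
      rw [sub_pos, div_lt_one (by positivity)]
      exact_mod_cast (by omega : 1 < k)
    have hpos : (0 : ℝ) < (permsWithoutBlockTwins n k m).card := by
      exact_mod_cast ih (by omega)
    exact_mod_cast (mul_pos hq hpos).trans_le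
      (one_sub_inv_mul_card_permsWithoutBlockTwins_le hk h m hm)

/-- For positive integers $k, n$ with $4ekn ≤ k!$ there is a permutation of $[n]$
containing no pair of block twins of length $k$. -/
theorem block_twins_upper (k n : ℕ) (hk : 1 ≤ k) (hn : 1 ≤ n)
    (h : 4 * Real.exp 1 * (k : ℝ) * (n : ℝ) ≤ (Nat.factorial k : ℝ)) :
    ∃ π : Equiv.Perm (Fin n), ¬ HasBlockTwins π k := by
  have hn' : (1 : ℝ) ≤ n := by exact_mod_cast hn
  have hexp : 1 < Real.exp 1 := by simp
  have hk2 : 2 ≤ k := by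
    by_contra hlt
    obtain rfl : k = 1 := by omega
    norm_num at h
    nlinarith
  have h' : Real.exp 1 * k * n ≤ (k.factorial : ℝ) := by
    have : 0 ≤ Real.exp 1 * k * n := by positivity
    linarith
  obtain ⟨π, hπ⟩ := Finset.card_pos.1 (card_permsWithoutBlockTwins_pos hk2 h' n le_rfl)
  refine ⟨π, ?_⟩
  rintro ⟨f, g, ht, hf, hg⟩
  exact mem_permsWithoutBlockTwins.1 hπ f g ht hf hg (fun a => (f a).2) (fun a => (g a).2)
end

section
/- The quantity bt(n)·(log log n)/(log n) tends to 1 as n → ∞; that is, bt(n) = (1 + o(1))·log n / log log n. -/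
/-- $bt(π)$: the maximum length of a pair of block twins in $π$. -/
noncomputable def btPerm {n : ℕ} (π : Equiv.Perm (Fin n)) : ℕ :=
  sSup {k | HasBlockTwins π k}

/-- $bt(n)$: the minimum of $bt(π)$ over all permutations of $[n]$. -/
noncomputable def bt (n : ℕ) : ℕ :=
  sInf (Set.range fun π : Equiv.Perm (Fin n) => btPerm π)

/-- The sequences `f` and `g` are order-isomorphic. -/
def SamePattern {k : ℕ} {X : Type*} [LT X] (f g : Fin k → X) : Prop :=
  ∀ a b, f a < f b ↔ g a < g b

theorem SamePattern.strictMono_comp_sort {k : ℕ} {X : Type*} [LinearOrder X] {f g : Fin k → X}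
    (h : SamePattern f g) (hf : Function.Injective f) : StrictMono (g ∘ Tuple.sort f) := by
  intro a b hab
  exact (h _ _).1 (((Tuple.monotone_sort f).strictMono_of_injective
    (hf.comp (Tuple.sort f).injective)) hab)

theorem SamePattern.eq_of_range_eq {k : ℕ} {X : Type*} [LinearOrder X] {f g : Fin k → X}
    (h : SamePattern f g) (hf : Function.Injective f) (hr : Set.range f = Set.range g) :
    f = g := by
  have h1 : StrictMono (f ∘ Tuple.sort f) :=
    SamePattern.strictMono_comp_sort (fun _ _ => Iff.rfl) hf
  have h2 := h.strictMono_comp_sort hf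
  have h3 : f ∘ Tuple.sort f = g ∘ Tuple.sort f := by
    rw [← StrictMono.range_inj h1 h2, (Tuple.sort f).surjective.range_comp,
      (Tuple.sort f).surjective.range_comp, hr]
  exact (Tuple.sort f).surjective.injective_comp_right h3

theorem samePattern_of_sort_eq {k : ℕ} {X : Type*} [LinearOrder X] {f g : Fin k → X}
    (hf : Function.Injective f) (hg : Function.Injective g) (h : Tuple.sort f = Tuple.sort g) :
    SamePattern f g := by
  have h1 : StrictMono (f ∘ Tuple.sort f) :=
    SamePattern.strictMono_comp_sort (fun _ _ => Iff.rfl) hf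
  have h2 : StrictMono (g ∘ Tuple.sort g) :=
    SamePattern.strictMono_comp_sort (fun _ _ => Iff.rfl) hg
  rw [← h] at h2
  intro a b
  have e1 := h1.lt_iff_lt (a := (Tuple.sort f).symm a) (b := (Tuple.sort f).symm b)
  have e2 := h2.lt_iff_lt (a := (Tuple.sort f).symm a) (b := (Tuple.sort f).symm b)
  simp only [Function.comp_apply, Equiv.apply_symm_apply] at e1 e2
  rw [e1, e2]

open Classical in
/-- Rearranging the values on the range of `e` is a free action of `Perm (Fin k)`, and each orbit
contains at most one permutation inducing on `e` the same pattern as on `f`. -/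
theorem factorial_mul_card_samePattern_le {n k : ℕ} (A : Finset (Equiv.Perm (Fin n)))
    (e f : Fin k ↪ Fin n) (hef : ∀ a b, e a ≠ f b)
    (hA : ∀ π ∈ A, ∀ σ : Equiv.Perm (Fin k), π * σ.viaFintypeEmbedding e ∈ A) :
    k.factorial * (A.filter fun π : Equiv.Perm (Fin n) => SamePattern (π ∘ f) (π ∘ e)).card ≤ A.card := by
  have hcard : ((Finset.univ : Finset (Equiv.Perm (Fin k))) ×ˢ
      (A.filter fun π : Equiv.Perm (Fin n) => SamePattern (π ∘ f) (π ∘ e))).card =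
      k.factorial * (A.filter fun π : Equiv.Perm (Fin n) => SamePattern (π ∘ f) (π ∘ e)).card := by
    rw [Finset.card_product, Finset.card_univ, Fintype.card_perm, Fintype.card_fin]
  rw [← hcard]
  refine Finset.card_le_card_of_injOn (fun p => p.2 * p.1.viaFintypeEmbedding e) ?_ ?_
  · rintro ⟨σ, π⟩ h
    simp only [Finset.coe_product, Finset.coe_univ, Set.mem_prod, Finset.mem_coe,
      Finset.mem_filter] at h
    exact hA π h.2.1 σ
  · rintro ⟨σ, π⟩ h ⟨σ', π'⟩ h' heq
    simp only [Finset.coe_product, Finset.coe_univ, Set.mem_prod, Finset.mem_coe,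
      Finset.mem_filter] at h h' heq
    have hf : π ∘ f = π' ∘ f := by
      funext b
      have := congrArg (fun ρ : Equiv.Perm (Fin n) => ρ (f b)) heq
      have hb : f b ∉ Set.range e := by rintro ⟨a, ha⟩; exact hef a b ha
      simpa [Equiv.Perm.viaFintypeEmbedding_apply_notMem_range _ _ hb] using this
    have he : ∀ a, π (e (σ a)) = π' (e (σ' a)) := by
      intro a
      have := congrArg (fun ρ : Equiv.Perm (Fin n) => ρ (e a)) heq
      simpa [Equiv.Perm.viaFintypeEmbedding_apply_image] using this
    have hr : Set.range (π ∘ e) = Set.range (π' ∘ e) := by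
      rw [← σ.surjective.range_comp (π ∘ e), ← σ'.surjective.range_comp (π' ∘ e)]
      exact congrArg Set.range (funext he)
    have hp : SamePattern (π ∘ e) (π' ∘ e) := fun a b => by
      rw [← h.2.2 a b, ← h'.2.2 a b, hf]
    have hee : π ∘ e = π' ∘ e := hp.eq_of_range_eq (π.injective.comp e.injective) hr
    have hσ : σ = σ' := by
      ext1 a
      have h1 := he a
      rw [← Function.comp_apply (f := π') (g := e), ← hee] at h1
      exact e.injective (π.injective h1)
    subst hσ
    rw [mul_left_inj] at heq
    rw [heq]

/-- The block of length `k` starting at position `i`. -/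
def blockEmb {n : ℕ} (k i : ℕ) (h : i + k ≤ n) : Fin k ↪ Fin n where
  toFun a := ⟨i + a, by omega⟩
  inj' a b hab := by
    simp only [Fin.mk.injEq] at hab
    omega

@[simp]
theorem coe_blockEmb {n k i : ℕ} (h : i + k ≤ n) (a : Fin k) : (blockEmb k i h a : ℕ) = i + a :=
  rfl

theorem isBlockFun_blockEmb {n k i : ℕ} (h : i + k ≤ n) : IsBlockFun (blockEmb k i h) :=
  ⟨i, fun _ => rfl⟩

theorem strictMono_blockEmb {n k i : ℕ} (h : i + k ≤ n) : StrictMono (blockEmb k i h) := by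
  intro a b hab
  rw [Fin.lt_def, coe_blockEmb, coe_blockEmb]
  omega

theorem blockEmb_ne {n k i j : ℕ} (hij : i + k ≤ j) (hi : i + k ≤ n) (hj : j + k ≤ n)
    (a b : Fin k) : blockEmb k i hi a ≠ blockEmb k j hj b := by
  rw [Fin.ne_iff_vne, coe_blockEmb, coe_blockEmb]
  omega

open Classical in
/-- The permutations without a pair of block twins of length `k` in the first `m` positions. -/
noncomputable def blockTwinFree (n k m : ℕ) : Finset (Equiv.Perm (Fin n)) :=
  Finset.univ.filter fun π => ∀ (i j : ℕ) (hi : i + k ≤ n) (hj : j + k ≤ n), i + k ≤ j →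
    j + k ≤ m → ¬ SamePattern (π ∘ blockEmb k i hi) (π ∘ blockEmb k j hj)

theorem mem_blockTwinFree {n k m : ℕ} {π : Equiv.Perm (Fin n)} :
    π ∈ blockTwinFree n k m ↔ ∀ (i j : ℕ) (hi : i + k ≤ n) (hj : j + k ≤ n), i + k ≤ j →
    j + k ≤ m → ¬ SamePattern (π ∘ blockEmb k i hi) (π ∘ blockEmb k j hj) := by
  simp [blockTwinFree]

theorem mul_viaFintypeEmbedding_mem_blockTwinFree {n k s : ℕ} (hs : s + k ≤ n)
    {π : Equiv.Perm (Fin n)} (hπ : π ∈ blockTwinFree n k s) (σ : Equiv.Perm (Fin k)) :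
    π * σ.viaFintypeEmbedding (blockEmb k s hs) ∈ blockTwinFree n k s := by
  rw [mem_blockTwinFree] at hπ ⊢
  intro i j hi hj hij hjs
  have key : ∀ (l : ℕ) (hl : l + k ≤ n), l + k ≤ s →
      (π * σ.viaFintypeEmbedding (blockEmb k s hs) : Equiv.Perm (Fin n)) ∘ blockEmb k l hl =
        π ∘ blockEmb k l hl := by
    intro l hl hls
    funext a
    have : blockEmb k l hl a ∉ Set.range (blockEmb k s hs) := by
      rintro ⟨b, hb⟩
      exact blockEmb_ne hls hl hs a b hb.symm
    simp [Equiv.Perm.viaFintypeEmbedding_apply_notMem_range _ _ this]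
  rw [key i hi (by omega), key j hj hjs]
  exact hπ i j hi hj hij hjs

open Classical in
theorem card_blockTwinFree_le {n k s : ℕ} (hs : s + k ≤ n) (hk : 0 < k) :
    (k.factorial : ℝ) * (blockTwinFree n k (s + k - 1)).card ≤
      k.factorial * (blockTwinFree n k (s + k)).card + n * (blockTwinFree n k s).card := by
  let B : ℕ → Finset (Equiv.Perm (Fin n)) := fun i =>
    if hi : i + k ≤ s then (blockTwinFree n k s).filter fun π =>
      SamePattern (π ∘ blockEmb k i (by omega)) (π ∘ blockEmb k s hs) else ∅
  have hB : ∀ i, k.factorial * (B i).card ≤ (blockTwinFree n k s).card := by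
    intro i
    simp only [B]
    split_ifs with hi
    · exact factorial_mul_card_samePattern_le _ (blockEmb k s hs) (blockEmb k i (by omega))
        (fun a b => (blockEmb_ne hi _ _ b a).symm)
        fun π hπ σ => mul_viaFintypeEmbedding_mem_blockTwinFree hs hπ σ
    · simp
  have hsub : blockTwinFree n k (s + k - 1) ⊆
      blockTwinFree n k (s + k) ∪ (Finset.range n).biUnion B := by
    intro π hπ
    rw [Finset.mem_union, or_iff_not_imp_left]
    intro hn
    rw [mem_blockTwinFree] at hπ hn
    push Not at hn
    obtain ⟨i, j, hi, hj, hij, hjs, hp⟩ := hn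
    have hj' : j = s := by
      by_contra hne
      exact hπ i j hi hj hij (by omega) hp
    subst hj'
    refine Finset.mem_biUnion.2 ⟨i, Finset.mem_range.2 (by omega), ?_⟩
    simp only [B, dif_pos hij, Finset.mem_filter]
    refine ⟨mem_blockTwinFree.2 fun i' j' hi' hj' h1 h2 => hπ i' j' hi' hj' h1 (by omega), hp⟩
  have h1 := (Finset.card_le_card hsub).trans ((Finset.card_union_le _ _).trans
    (Nat.add_le_add_left Finset.card_biUnion_le _))
  have h2 : k.factorial * ∑ i ∈ Finset.range n, (B i).card ≤
      n * (blockTwinFree n k s).card := by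
    rw [Finset.mul_sum]
    refine (Finset.sum_le_sum fun i _ => hB i).trans ?_
    simp
  have h3 := Nat.mul_le_mul_left k.factorial h1
  rw [mul_add] at h3
  exact_mod_cast h3.trans (Nat.add_le_add_left h2 _)

/-- Each further position costs at most a fraction `1 / (2k)` of the twin-free permutations. -/
theorem card_blockTwinFree_succ_ge {n k : ℕ} (hk : 0 < k) (hn : 4 * k * n ≤ k.factorial) (m : ℕ)
    (hm : m < n) :
    (1 - 1 / (2 * k) : ℝ) * (blockTwinFree n k m).card ≤ (blockTwinFree n k (m + 1)).card := by
  have hk1 : (1 : ℝ) ≤ k := by exact_mod_cast hk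
  have hinv : (1 : ℝ) / (2 * k) ≤ 1 / 2 := by
    rw [div_le_div_iff₀ (by positivity) (by norm_num)]; linarith
  have hinv0 : (0 : ℝ) ≤ 1 / (2 * k) := by positivity
  set β : ℝ := 1 - 1 / (2 * k) with hβ
  have hβ0 : 0 ≤ β := by linarith
  induction m using Nat.strong_induction_on with
  | _ m ih =>
    rcases lt_or_ge (m + 1) k with hmk | hmk
    · have hsub : blockTwinFree n k m ⊆ blockTwinFree n k (m + 1) := by
        intro π _
        rw [mem_blockTwinFree]
        intro i j hi hj h1 h2
        omega
      have : ((blockTwinFree n k m).card : ℝ) ≤ (blockTwinFree n k (m + 1)).card := by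
        exact_mod_cast Finset.card_le_card hsub
      have h0 : (0 : ℝ) ≤ (blockTwinFree n k m).card := by positivity
      nlinarith
    · obtain ⟨s, rfl⟩ : ∃ s, m = s + (k - 1) := ⟨m + 1 - k, by omega⟩
      have hpow : ∀ t ≤ k - 1, β ^ t * (blockTwinFree n k s).card ≤
          (blockTwinFree n k (s + t)).card := by
        intro t
        induction t with
        | zero => simp
        | succ t iht =>
          intro ht
          have h1 := iht (by omega)
          have h2 := ih (s + t) (by omega) (by omega)
          calc β ^ (t + 1) * (blockTwinFree n k s).card
              = β * (β ^ t * (blockTwinFree n k s).card) := by ring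
            _ ≤ β * (blockTwinFree n k (s + t)).card := by gcongr
            _ ≤ _ := h2
      have h1 := hpow (k - 1) le_rfl
      have hbern : (1 / 2 : ℝ) ≤ β ^ (k - 1) := by
        have := one_add_mul_le_pow (a := -(1 / (2 * k) : ℝ)) (by linarith) (k - 1)
        rw [← sub_eq_add_neg, Nat.cast_sub hk, Nat.cast_one] at this
        refine le_trans ?_ this
        have : (k : ℝ) * (1 / (2 * k)) = 1 / 2 := by field_simp
        nlinarith
      have h2 := card_blockTwinFree_le (n := n) (k := k) (s := s) (by omega) hk
      rw [show s + k - 1 = s + (k - 1) by omega] at h2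
      rw [show s + (k - 1) + 1 = s + k by omega]
      have hc : ((blockTwinFree n k s).card : ℝ) ≤ 2 * (blockTwinFree n k (s + (k - 1))).card := by
        have : (0 : ℝ) ≤ (blockTwinFree n k s).card := by positivity
        nlinarith
      have hF : (n : ℝ) * 2 ≤ k.factorial * (1 / (2 * k)) := by
        have : (4 * k * n : ℝ) ≤ k.factorial := by exact_mod_cast hn
        rw [mul_one_div, le_div_iff₀ (by positivity)]
        linarith
      have hF0 : (0 : ℝ) < k.factorial := by exact_mod_cast k.factorial_pos
      have h3 : (n : ℝ) * (blockTwinFree n k s).card ≤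
          k.factorial * (1 / (2 * k)) * (blockTwinFree n k (s + (k - 1))).card := by
        calc (n : ℝ) * (blockTwinFree n k s).card
            ≤ n * (2 * (blockTwinFree n k (s + (k - 1))).card) := by gcongr
          _ = n * 2 * (blockTwinFree n k (s + (k - 1))).card := by ring
          _ ≤ _ := by gcongr
      refine le_of_mul_le_mul_left ?_ hF0
      rw [hβ]
      linarith

theorem blockTwinFree_nonempty {n k : ℕ} (hk : 0 < k) (hn : 4 * k * n ≤ k.factorial) :
    (blockTwinFree n k n).Nonempty := by
  have hk1 : (1 : ℝ) ≤ k := by exact_mod_cast hk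
  have hβ : (0 : ℝ) < 1 - 1 / (2 * k) := by
    have : (1 : ℝ) / (2 * k) ≤ 1 / 2 := by
      rw [div_le_div_iff₀ (by positivity) (by norm_num)]; linarith
    linarith
  have h : ∀ m ≤ n, (0 : ℝ) < (blockTwinFree n k m).card := by
    intro m
    induction m with
    | zero =>
      intro _
      have : (1 : Equiv.Perm (Fin n)) ∈ blockTwinFree n k 0 := by
        rw [mem_blockTwinFree]
        intros
        omega
      exact_mod_cast Finset.card_pos.2 ⟨_, this⟩
    | succ m ih =>
      intro hm
      exact (mul_pos hβ (ih (by omega))).trans_le (card_blockTwinFree_succ_ge hk hn m (by omega))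
  exact Finset.card_pos.1 (by exact_mod_cast h n le_rfl)

theorem eq_blockEmb_of_forall {n k s : ℕ} (hk : 0 < k) {f : Fin k → Fin n}
    (hf : ∀ a, (f a : ℕ) = s + a) : ∃ h : s + k ≤ n, f = blockEmb k s h := by
  have h1 := hf ⟨k - 1, by omega⟩
  have h2 := (f ⟨k - 1, by omega⟩).2
  simp only at h1
  exact ⟨by omega, funext fun a => Fin.ext (hf a)⟩

theorem not_hasBlockTwins_of_mem_blockTwinFree {n k : ℕ} (hk : 0 < k) {π : Equiv.Perm (Fin n)}
    (hπ : π ∈ blockTwinFree n k n) : ¬ HasBlockTwins π k := by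
  rintro ⟨f, g, ⟨-, -, hd, hp⟩, ⟨i, hf⟩, ⟨j, hg⟩⟩
  obtain ⟨hi, rfl⟩ := eq_blockEmb_of_forall hk hf
  obtain ⟨hj, rfl⟩ := eq_blockEmb_of_forall hk hg
  rw [mem_blockTwinFree] at hπ
  rcases le_or_gt (i + k) j with h | h
  · exact hπ i j hi hj h hj hp
  rcases le_or_gt (j + k) i with h' | h'
  · exact hπ j i hj hi h' hi fun a b => (hp a b).symm
  rcases le_or_gt i j with h'' | h''
  · refine hd ⟨j - i, by omega⟩ ⟨0, hk⟩ (Fin.ext ?_)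
    rw [coe_blockEmb, coe_blockEmb]
    simp only
    omega
  · refine hd ⟨0, hk⟩ ⟨i - j, by omega⟩ (Fin.ext ?_)
    rw [coe_blockEmb, coe_blockEmb]
    simp only
    omega

theorem HasBlockTwins.mono {n k l : ℕ} {π : Equiv.Perm (Fin n)} (h : HasBlockTwins π l)
    (hkl : k ≤ l) : HasBlockTwins π k := by
  obtain ⟨f, g, ⟨hf, hg, hd, hp⟩, ⟨i, hi⟩, ⟨j, hj⟩⟩ := h
  exact ⟨f ∘ Fin.castLE hkl, g ∘ Fin.castLE hkl,
    ⟨hf.comp (Fin.strictMono_castLE hkl), hg.comp (Fin.strictMono_castLE hkl),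
      fun a b => hd _ _, fun a b => hp _ _⟩, ⟨i, fun a => hi _⟩, ⟨j, fun a => hj _⟩⟩

theorem bddAbove_hasBlockTwins {n : ℕ} (π : Equiv.Perm (Fin n)) :
    BddAbove {k | HasBlockTwins π k} := by
  refine ⟨n, ?_⟩
  rintro k ⟨f, -, ⟨hf, -⟩, -⟩
  simpa using Fintype.card_le_of_injective f hf.injective

theorem bt_lt {n k : ℕ} (hk : 0 < k) (hn : 4 * k * n ≤ k.factorial) : bt n < k := by
  obtain ⟨π, hπ⟩ := blockTwinFree_nonempty hk hn
  refine (Nat.sInf_le (Set.mem_range_self π)).trans_lt ?_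
  by_contra! hlt
  have hmem : btPerm π ∈ {k | HasBlockTwins π k} := by
    refine Nat.sSup_mem (Set.nonempty_iff_ne_empty.2 fun h => ?_) (bddAbove_hasBlockTwins π)
    simp [btPerm, h] at hlt
    omega
  exact not_hasBlockTwins_of_mem_blockTwinFree hk hπ (HasBlockTwins.mono hmem hlt)

/-- Among more than `k!` disjoint blocks of length `k`, two have the same pattern. -/
theorem hasBlockTwins_of_mul_le {n k : ℕ} (hn : k * (k.factorial + 1) ≤ n)
    (π : Equiv.Perm (Fin n)) : HasBlockTwins π k := by
  have hblk : ∀ t : Fin (k.factorial + 1), k * t + k ≤ n := fun t => by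
    refine le_trans ?_ hn
    rw [← Nat.mul_succ]
    exact Nat.mul_le_mul_left k t.2
  have key : ∀ s t : Fin (k.factorial + 1), s < t →
      Tuple.sort (π ∘ blockEmb k (k * s) (hblk s)) = Tuple.sort (π ∘ blockEmb k (k * t) (hblk t)) →
      HasBlockTwins π k := fun s t hst heq => by
    have hle : k * s + k ≤ k * t := by
      rw [← Nat.mul_succ]
      exact Nat.mul_le_mul_left k hst
    refine ⟨blockEmb k (k * s) (hblk s), blockEmb k (k * t) (hblk t),
      ⟨strictMono_blockEmb _, strictMono_blockEmb _, blockEmb_ne hle _ _, ?_⟩,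
      isBlockFun_blockEmb _, isBlockFun_blockEmb _⟩
    exact samePattern_of_sort_eq (π.injective.comp (blockEmb _ _ _).injective)
      (π.injective.comp (blockEmb _ _ _).injective) heq
  obtain ⟨s, t, hne, heq⟩ := Fintype.exists_ne_map_eq_of_card_lt
    (fun t : Fin (k.factorial + 1) => Tuple.sort (π ∘ blockEmb k (k * t) (hblk t)))
    (by simp [Fintype.card_perm])
  rcases lt_or_gt_of_ne hne with h | h
  · exact key s t h heq
  · exact key t s h heq.symm

theorem le_bt {n k : ℕ} (hn : k * (k.factorial + 1) ≤ n) : k ≤ bt n := by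
  obtain ⟨π, hπ⟩ := Nat.sInf_mem (Set.range_nonempty fun π : Equiv.Perm (Fin n) => btPerm π)
  rw [bt, ← hπ]
  exact le_csSup (bddAbove_hasBlockTwins π) (hasBlockTwins_of_mul_le hn π)

theorem tendsto_bt_atTop : Filter.Tendsto bt Filter.atTop Filter.atTop := by
  rw [Filter.tendsto_atTop]
  intro k
  filter_upwards [Filter.eventually_ge_atTop (k * (k.factorial + 1))] with n hn
  exact le_bt hn

theorem log_le_of_bt_pos {n : ℕ} (hn : 0 < n) (hb : 0 < bt n) :
    Real.log n ≤ (bt n + 3) * (Real.log (bt n) + Real.log 2) := by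
  have hlt : n < (bt n + 1) * ((bt n + 1).factorial + 1) := by
    by_contra! h
    have := le_bt h
    omega
  set b := bt n
  have hfac : (b + 1).factorial + 1 ≤ (b + 1) ^ (b + 2) := by
    have h1 := Nat.factorial_le_pow (b + 1)
    have h2 : 1 ≤ (b + 1) ^ (b + 1) := Nat.one_le_pow _ _ (by omega)
    rw [pow_succ (b + 1) (b + 1)]
    nlinarith
  have hle : n ≤ (2 * b) ^ (b + 3) :=
    calc n ≤ (b + 1) * ((b + 1).factorial + 1) := hlt.le
      _ ≤ (b + 1) * (b + 1) ^ (b + 2) := Nat.mul_le_mul_left _ hfac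
      _ = (b + 1) ^ (b + 3) := by ring
      _ ≤ (2 * b) ^ (b + 3) := Nat.pow_le_pow_left (by omega) _
  have hb' : (0 : ℝ) < b := by exact_mod_cast hb
  calc Real.log n ≤ Real.log ((2 * b) ^ (b + 3)) :=
        Real.log_le_log (by exact_mod_cast hn) (by exact_mod_cast hle)
    _ = _ := by
      rw [Real.log_pow, Real.log_mul two_ne_zero hb'.ne']
      push_cast
      ring

theorem le_log_of_bt_pos {n : ℕ} (hn : 0 < n) (hb : 0 < bt n) :
    bt n * Real.log (bt n) - bt n - (Real.log 4 + Real.log (bt n)) ≤ Real.log n := by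
  have hlt : (bt n).factorial < 4 * bt n * n := by
    by_contra! h
    exact (bt_lt hb h).false
  set b := bt n
  have hb' : (0 : ℝ) < b := by exact_mod_cast hb
  have hn' : (0 : ℝ) < n := by exact_mod_cast hn
  have hF0 : (0 : ℝ) < b.factorial := by exact_mod_cast b.factorial_pos
  have h1 := Real.pow_div_factorial_le_exp (b : ℝ) hb'.le b
  have h2 : (b : ℝ) ^ b ≤ Real.exp b * (4 * b * n) := by
    rw [div_le_iff₀ hF0] at h1
    refine h1.trans ?_
    gcongr
    exact_mod_cast hlt.le
  have h3 := Real.log_le_log (by positivity) h2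
  rw [Real.log_pow, Real.log_mul (Real.exp_pos _).ne' (by positivity), Real.log_exp,
    Real.log_mul (by positivity) hn'.ne', Real.log_mul (by norm_num) hb'.ne'] at h3
  linarith

theorem tendsto_log_div_bt_mul_log_bt :
    Filter.Tendsto (fun n : ℕ => Real.log n / (bt n * Real.log (bt n)))
      Filter.atTop (nhds 1) := by
  have hx : Filter.Tendsto (fun n => (bt n : ℝ)) Filter.atTop Filter.atTop :=
    tendsto_natCast_atTop_atTop.comp tendsto_bt_atTop
  have hL := Real.tendsto_log_atTop.comp hx
  have hxi := tendsto_inv_atTop_zero.comp hx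
  have hLi := tendsto_inv_atTop_zero.comp hL
  simp only [Function.comp_def] at hL hxi hLi
  have hup : Filter.Tendsto
      (fun n => (1 + 3 * (bt n : ℝ)⁻¹) * (1 + Real.log 2 * (Real.log (bt n))⁻¹))
      Filter.atTop (nhds 1) := by
    simpa using ((hxi.const_mul 3).const_add 1).mul ((hLi.const_mul (Real.log 2)).const_add 1)
  have hlo : Filter.Tendsto
      (fun n => 1 - (Real.log (bt n))⁻¹ -
        (Real.log 4 * ((bt n : ℝ)⁻¹ * (Real.log (bt n))⁻¹) + (bt n : ℝ)⁻¹))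
      Filter.atTop (nhds 1) := by
    simpa using (hLi.const_sub 1).sub (((hxi.mul hLi).const_mul (Real.log 4)).add hxi)
  refine tendsto_of_tendsto_of_tendsto_of_le_of_le' hlo hup ?_ ?_
  · filter_upwards [hx.eventually_gt_atTop 0, hL.eventually_gt_atTop 0,
      Filter.eventually_gt_atTop 0] with n h1 h2 h3
    rw [le_div_iff₀ (by positivity)]
    refine le_trans (le_of_eq ?_) (le_log_of_bt_pos h3 (by exact_mod_cast h1))
    field_simp
  · filter_upwards [hx.eventually_gt_atTop 0, hL.eventually_gt_atTop 0,
      Filter.eventually_gt_atTop 0] with n h1 h2 h3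
    rw [div_le_iff₀ (by positivity)]
    refine (log_le_of_bt_pos h3 (by exact_mod_cast h1)).trans (le_of_eq ?_)
    field_simp

theorem tendsto_log_log_div_log_bt :
    Filter.Tendsto (fun n : ℕ => Real.log (Real.log n) / Real.log (bt n))
      Filter.atTop (nhds 1) := by
  have hx : Filter.Tendsto (fun n => (bt n : ℝ)) Filter.atTop Filter.atTop :=
    tendsto_natCast_atTop_atTop.comp tendsto_bt_atTop
  have hL := Real.tendsto_log_atTop.comp hx
  have hr := tendsto_log_div_bt_mul_log_bt
  have hLL := Real.isLittleO_log_id_atTop.tendsto_div_nhds_zero.comp hL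
  have hlr := ((Real.continuousAt_log one_ne_zero).tendsto.comp hr).mul
    (tendsto_inv_atTop_zero.comp hL)
  simp only [Function.comp_def, id_eq] at hL hLL hlr
  have hsum := (hlr.add hLL).add_const 1
  simp only [Real.log_one, zero_mul, zero_add] at hsum
  refine hsum.congr' ?_
  filter_upwards [hx.eventually_gt_atTop 0, hL.eventually_gt_atTop 0,
    Filter.eventually_gt_atTop 1] with n h1 h2 h3
  have h4 : 0 < Real.log n := Real.log_pos (by exact_mod_cast h3)
  rw [Real.log_div h4.ne' (by positivity), Real.log_mul h1.ne' h2.ne']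
  field_simp
  ring

/-- $bt(n) = (1+o(1))·\log n/\log\log n$. -/
theorem bt_asymptotics :
    Filter.Tendsto
      (fun n : ℕ => (bt n : ℝ) * Real.log (Real.log n) / Real.log n)
      Filter.atTop (nhds 1) := by
  have h := tendsto_log_log_div_log_bt.div tendsto_log_div_bt_mul_log_bt one_ne_zero
  rw [div_one] at h
  refine h.congr' ?_
  filter_upwards [tendsto_bt_atTop.eventually_gt_atTop 1, Filter.eventually_gt_atTop 1] with n h1 h2
  have h3 : (0 : ℝ) < bt n := by exact_mod_cast zero_lt_one.trans h1
  have h4 : 0 < Real.log (bt n) := Real.log_pos (by exact_mod_cast h1)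
  have h5 : 0 < Real.log n := Real.log_pos (by exact_mod_cast h2)
  simp only [Pi.div_apply]
  field_simp
end
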